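/- arXiv:1207.0237 — 2 statements merged into one kernel-verified Lean document; each statement's English description precedes it below -/
import Mathlib

section
/- For each n ≥ 3, there exists k such that if a tournament G has no subtournament isomorphic to K_n or to K_n*, then G can be written as T_r(H_1,…,H_r), where r ≥ 1 is odd and for each 1 ≤ i ≤ r the tournament H_i has no subtournament isomorphic to J_k. -/
/-- A tournament on a vertex type `V`: for any two distinct vertices exactly one of the
two possible directed edges is present. -/
structure Tournament (V : Type) where
  rel : V → V → Prop
  asymm : ∀ u v, rel u v → ¬ rel v u
  total : ∀ u v, u ≠ v → rel u v ∨ rel v u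

namespace Tournament

variable {V : Type}

/-- `X` is a homogeneous set of the subtournament of `T` induced on `S`. -/
def HomogOn (T : Tournament V) (S X : Set V) : Prop :=
  X ⊆ S ∧ ∀ v ∈ S \ X, (∀ x ∈ X, T.rel v x) ∨ (∀ x ∈ X, T.rel x v)

/-- The subtournament of `T` induced on `S` is prime: it is a (nonempty) tournament all
of whose homogeneous sets are trivial. -/
def PrimeOn (T : Tournament V) (S : Set V) : Prop :=
  S.Nonempty ∧ ∀ X : Set V, T.HomogOn S X → X.ncard ≤ 1 ∨ X = S

/-- The subtournament of `T` induced on `S` is isomorphic to the tournament on `Fin n`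
with edge relation `r`. -/
def IsoOnFin (T : Tournament V) (S : Set V) {n : ℕ} (r : Fin n → Fin n → Prop) : Prop :=
  ∃ f : Fin n → V, Function.Injective f ∧ Set.range f = S ∧
    ∀ i j : Fin n, r i j ↔ T.rel (f i) (f j)

/-- `T` has a subtournament isomorphic to the tournament on `Fin n` with edge relation `r`. -/
def HasSub (T : Tournament V) {n : ℕ} (r : Fin n → Fin n → Prop) : Prop :=
  ∃ f : Fin n → V, Function.Injective f ∧ ∀ i j : Fin n, r i j ↔ T.rel (f i) (f j)

/-- The subtournament of `T` induced on `S` has a subtournament isomorphic to the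
tournament on `Fin n` with edge relation `r`. -/
def HasSubIn (T : Tournament V) (S : Set V) {n : ℕ} (r : Fin n → Fin n → Prop) : Prop :=
  ∃ f : Fin n → V, Function.Injective f ∧ (∀ i, f i ∈ S) ∧
    ∀ i j : Fin n, r i j ↔ T.rel (f i) (f j)

/-- `v ∈ Ext(H)`: `v` is outside `H` and `H + v` is prime. -/
def mem_Ext (T : Tournament V) (H : Set V) (v : V) : Prop :=
  v ∉ H ∧ T.PrimeOn (insert v H)

/-- `v ∈ Z(H)`: `v` is outside `H` and `H` is a homogeneous set of `H + v`. -/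
def mem_Z (T : Tournament V) (H : Set V) (v : V) : Prop :=
  v ∉ H ∧ T.HomogOn (insert v H) H

/-- `v ∈ V_x(H)`: `v` is outside `H` and `{v, x}` is a homogeneous set of `H + v`. -/
def mem_Vx (T : Tournament V) (H : Set V) (x v : V) : Prop :=
  v ∉ H ∧ T.HomogOn (insert v H) {v, x}

/-- `C` is (the vertex set of) a cyclic triangle of `T`. -/
def CycTri (T : Tournament V) (C : Set V) : Prop :=
  ∃ a b c : V, C = {a, b, c} ∧ T.rel a b ∧ T.rel b c ∧ T.rel c a

/-- The cyclic triangles `C` and `C'` are triangle-connected: there is a sequence of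
cyclic triangles from `C` to `C'` in which consecutive triangles share exactly two
vertices. -/
def TriConn (T : Tournament V) (C C' : Set V) : Prop :=
  ∃ m : ℕ, ∃ f : Fin (m + 1) → Set V,
    f 0 = C ∧ f (Fin.last m) = C' ∧ (∀ i, T.CycTri (f i)) ∧
    ∀ i : Fin m, ((f i.castSucc) ∩ (f i.succ)).ncard = 2

/-- `T` is strongly connected. -/
def StronglyConnected (T : Tournament V) : Prop :=
  ∀ u v : V, Relation.ReflTransGen T.rel u v

/-- The subtournament of `T` induced on `S` is a transitive tournament. -/
def TransOn (T : Tournament V) (S : Set V) : Prop :=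
  ∃ m : ℕ, ∃ f : Fin m → V, Function.Injective f ∧ Set.range f = S ∧
    ∀ i j : Fin m, i < j → T.rel (f i) (f j)

end Tournament

/-- The tournament `T_n` (`n = 2k+1` odd) on `Fin n`: `i → j` iff `j - i mod n ∈ {1, …, k}`. -/
def TTrel (n : ℕ) (i j : Fin n) : Prop :=
  1 ≤ (j.val + n - i.val) % n ∧ (j.val + n - i.val) % n ≤ n / 2

/-- The tournament `U_n`: obtained from `T_n` by reversing all edges with both ends among
the first `k` vertices. -/
def UUrel (n : ℕ) (i j : Fin n) : Prop :=
  if i.val < n / 2 ∧ j.val < n / 2 then TTrel n j i else TTrel n i j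

/-- The tournament `W_n` on `Fin n` (vertex `n-1` plays the role of `w_n`). -/
def WWrel (n : ℕ) (i j : Fin n) : Prop :=
  (i.val < j.val ∧ j.val < n - 1) ∨ (j.val = n - 1 ∧ i.val < n - 1 ∧ i.val % 2 = 1) ∨
    (i.val = n - 1 ∧ j.val < n - 1 ∧ j.val % 2 = 0)

/-- The tournament `P_n` on `Fin n`: `i → j` iff `j - i ≥ 2` or `i = j + 1`. -/
def PPrel (n : ℕ) (i j : Fin n) : Prop := i.val + 2 ≤ j.val ∨ i.val = j.val + 1

/-- The tournament `D_4`: vertex `0` beats the cyclic triangle `{1, 2, 3}`. -/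
def DDrel (i j : Fin 4) : Prop :=
  (i = 0 ∧ j ≠ 0) ∨ (i = 1 ∧ j = 2) ∨ (i = 2 ∧ j = 3) ∨ (i = 3 ∧ j = 1)

/-- The tournament `J_n` on `Fin n`: the identity ordering has exactly one backedge,
from the last vertex to the first. -/
def JJrel (n : ℕ) (i j : Fin n) : Prop :=
  (i.val < j.val ∧ ¬(i.val = 0 ∧ j.val = n - 1)) ∨ (i.val = n - 1 ∧ j.val = 0)

/-- The tournament `K_n` on `Fin n`: the identity ordering has exactly one backedge,
from the last vertex to the second. -/
def KKrel (n : ℕ) (i j : Fin n) : Prop :=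
  (i.val < j.val ∧ ¬(i.val = 1 ∧ j.val = n - 1)) ∨ (i.val = n - 1 ∧ j.val = 1)

/-- The tournament `K_n^*` on `Fin n`: the identity ordering has exactly one backedge,
from the second-to-last vertex to the first. -/
def KKsrel (n : ℕ) (i j : Fin n) : Prop :=
  (i.val < j.val ∧ ¬(i.val = 0 ∧ j.val = n - 2)) ∨ (i.val = n - 2 ∧ j.val = 0)

/-- `(j, i)` (0-indexed, `i < j`) is one of the backedges of the defining ordering of `Q_n`. -/
def Qback (n i j : ℕ) : Prop :=
  (j = n - 2 ∧ i = 0) ∨ (j = n - 1 ∧ i = n - 3) ∨ (j = i + 1 ∧ j ≤ n - 3)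

/-- The tournament `Q_n` on `Fin n`. -/
def QQrel (n : ℕ) (i j : Fin n) : Prop :=
  (i.val < j.val ∧ ¬ Qback n i.val j.val) ∨ (j.val < i.val ∧ Qback n j.val i.val)

/-- `e` is a matching ordering of the tournament with edge relation `r` on `V`:
`e` lists all vertices and every vertex is the head or tail of at most one backedge. -/
def MatchingOrd {V : Type} (r : V → V → Prop) {m : ℕ} (e : Fin m → V) : Prop :=
  Function.Bijective e ∧
    ∀ i : Fin m, {j : Fin m | (i < j ∧ r (e j) (e i)) ∨ (j < i ∧ r (e i) (e j))}.Subsingleton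

/-- `e` is a matching ordering of the subtournament induced on `S`. -/
def MatchingOrdOn {V : Type} (r : V → V → Prop) (S : Set V) {m : ℕ} (e : Fin m → V) : Prop :=
  Set.BijOn e Set.univ S ∧
    ∀ i : Fin m, {j : Fin m | (i < j ∧ r (e j) (e i)) ∨ (j < i ∧ r (e i) (e j))}.Subsingleton

/-- The subtournament induced on `S` is a matching tournament. -/
def IsMatchingOn {V : Type} (r : V → V → Prop) (S : Set V) : Prop :=
  ∃ m : ℕ, ∃ e : Fin m → V, MatchingOrdOn r S e

/-- The permutation `σ_X` of the interval of integers `X = {b, …, a}` (identity off `X`):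
the cycle `(b b+2 … a-2 a a-1 a-3 … b+1)` when `|X|` is odd and
`(b b+2 … a-1 a a-2 … b+1)` when `|X|` is even. -/
def sigmaX (b a x : ℕ) : ℕ :=
  if x < b ∨ a < x then x
  else if a = b then x
  else if (x - b) % 2 = 0 then
    (if x + 2 ≤ a then x + 2 else if x + 1 ≤ a then x + 1 else x - 1)
  else (if b + 3 ≤ x then x - 2 else b)

/-- The permutation `τ_X = (b b+2)(b+1 b+3)` of `X = {b, b+1, b+2, b+3}`. -/
def tauX (b x : ℕ) : ℕ :=
  if x = b then b + 2 else if x = b + 2 then b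
  else if x = b + 1 then b + 3 else if x = b + 3 then b + 1 else x

/-- The permutation `π_1` of the interval `{b, …, a}`: product of the transpositions
swapping the 1st and 2nd, 3rd and 4th, … elements of the interval. -/
def pi1N (b a x : ℕ) : ℕ :=
  if x < b ∨ a < x then x
  else if (x - b) % 2 = 0 then (if x + 1 ≤ a then x + 1 else x)
  else x - 1

/-- The permutation `π_2` of the interval `{b, …, a}`: product of the transpositions
swapping the 2nd and 3rd, 4th and 5th, … elements of the interval. -/
def pi2N (b a x : ℕ) : ℕ :=
  if x < b ∨ a < x then x
  else if x = b then x
  else if (x - b) % 2 = 1 then (if x + 1 ≤ a then x + 1 else x)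
  else x - 1

/-- The segment of the ordering `e` on positions `b, …, a` induces a transitive tournament,
with ordering given (relative to the standard ordering `f`) by the permutation `p`. -/
def SegTrans {V : Type} (T : Tournament V) {n : ℕ} (e : Fin n → V) (b a : ℕ) (p : ℕ → ℕ) : Prop :=
  ∃ f : ℕ → V, (∀ x y : ℕ, b ≤ x → x < y → y ≤ a → T.rel (f x) (f y)) ∧
    ∀ i : Fin n, b ≤ i.val → i.val ≤ a → e i = f (p i.val)

/-- The segment of the ordering `e` on positions `b, …, a` induces a tournament isomorphic
to `P_m` (where `m = a - b + 1`), with ordering given (relative to the defining ordering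
`f` of `P_m`) by the permutation `p`. -/
def SegP {V : Type} (T : Tournament V) {n : ℕ} (e : Fin n → V) (b a : ℕ) (p : ℕ → ℕ) : Prop :=
  ∃ f : ℕ → V,
    (∀ x y : ℕ, b ≤ x → x ≤ a → b ≤ y → y ≤ a →
      (T.rel (f x) (f y) ↔ (x + 2 ≤ y ∨ x = y + 1))) ∧
    ∀ i : Fin n, b ≤ i.val → i.val ≤ a → e i = f (p i.val)


namespace Tournament
variable {V : Type}

/-- A good decomposition of the subtournament induced on `S`: the classes of `e` are
homogeneous, the quotient is locally transitive, every edge of the quotient is in a cyclic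
triangle, and there are at least two classes. -/
structure Good (T : Tournament V) (S : Set V) (e : V → V → Prop) : Prop where
  rfl' : ∀ x ∈ S, e x x
  sym : ∀ x ∈ S, ∀ y ∈ S, e x y → e y x
  trn : ∀ x ∈ S, ∀ y ∈ S, ∀ z ∈ S, e x y → e y z → e x z
  mod : ∀ x ∈ S, ∀ y ∈ S, ∀ z ∈ S, e x y → ¬ e x z → T.rel x z → T.rel y z
  mod' : ∀ x ∈ S, ∀ y ∈ S, ∀ z ∈ S, e x y → ¬ e x z → T.rel z x → T.rel z y
  lt : ∀ x ∈ S, ∀ p ∈ S, ∀ q ∈ S, ∀ s ∈ S, T.rel p q → T.rel q s → T.rel s p →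
    T.rel x p → T.rel x q → T.rel x s → e p q
  lt' : ∀ x ∈ S, ∀ p ∈ S, ∀ q ∈ S, ∀ s ∈ S, T.rel p q → T.rel q s → T.rel s p →
    T.rel p x → T.rel q x → T.rel s x → e p q
  ex : ∀ x ∈ S, ∀ y ∈ S, T.rel x y → ¬ e x y → ∃ z ∈ S, T.rel y z ∧ T.rel z x
  nt : ∃ x ∈ S, ∃ y ∈ S, ¬ e x y

/-- `p, q, s` is a cyclic triangle, in this orientation. -/
def Cyc (T : Tournament V) (p q s : V) : Prop := T.rel p q ∧ T.rel q s ∧ T.rel s p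

/-- `x` is complete to or from `p, q, s`. -/
def Hom3 (T : Tournament V) (x p q s : V) : Prop :=
  (T.rel x p ∧ T.rel x q ∧ T.rel x s) ∨ (T.rel p x ∧ T.rel q x ∧ T.rel s x)

/-- `x` is complete to or from the cyclic triangle `p, q, s` (some orientation). -/
def Bad (T : Tournament V) (x p q s : V) : Prop :=
  (T.Cyc p q s ∨ T.Cyc p s q) ∧ T.Hom3 x p q s

/-- the four vertices induce `D_4` or its reverse -/
def D4 (T : Tournament V) (a b c d : V) : Prop :=
  T.Bad a b c d ∨ T.Bad b a c d ∨ T.Bad c a b d ∨ T.Bad d a b c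

/-- No bad triangle made of `α` and elements of `F`. -/
def Fat (T : Tournament V) (F : Set V) (α : V) : Prop :=
  α ∉ F ∧ ∀ c ∈ F, ∀ d ∈ F, ∀ w ∈ F, ¬ T.Bad w α c d

theorem irr (T : Tournament V) (x : V) : ¬ T.rel x x := fun h => T.asymm x x h h

theorem relnot (T : Tournament V) {x y : V} (h : x ≠ y) : T.rel y x ↔ ¬ T.rel x y :=
  ⟨fun a b => T.asymm _ _ a b, fun a => (T.total x y h).resolve_left a⟩

/-- The edge `q → s` separated by `w`, no D4 of `v, α, q, s`. -/
theorem L3 (T : Tournament V) {S F : Set V} {e} (hG : T.Good S e) {v α q s w : V}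
    (hv : v ∉ S) (hα : α ∈ S) (hF : T.Fat F α) (hq : q ∈ S) (hs : s ∈ S) (hw : w ∈ S)
    (vF : v ∈ F) (qF : q ∈ F) (sF : s ∈ F) (wF : w ∈ F)
    (hqs : ¬ e q s) (h1 : T.rel q s) (h2 : T.rel s w) (h3 : T.rel w q) :
    ¬ T.D4 v α q s := by
  have n1 : v ≠ α := by rintro rfl; exact hv hα
  have n2 : v ≠ w := by rintro rfl; exact hv hw
  have n3 : v ≠ q := by rintro rfl; exact hv hq
  have n4 : v ≠ s := by rintro rfl; exact hv hs
  have n5 : α ≠ q := by rintro rfl; exact hF.1 qF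
  have n6 : α ≠ s := by rintro rfl; exact hF.1 sF
  have n7 : α ≠ w := by rintro rfl; exact hF.1 wF
  have a1 := hF.2 v vF q qF s sF
  have a2 := hF.2 v vF s sF q qF
  have a3 := hF.2 q qF s sF v vF
  have a4 := hF.2 v vF w wF q qF
  have a5 := hF.2 s sF w wF v vF
  have a6 := hF.2 v vF w wF s sF
  have a7 := hF.2 q qF w wF v vF
  have b1 := hG.lt α hα q hq s hs w hw h1 h2 h3
  have b2 := hG.lt' α hα q hq s hs w hw h1 h2 h3
  have r1 := T.asymm _ _ h1
  have r2 := T.asymm _ _ h2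
  have r3 := T.asymm _ _ h3
  have k1 := T.relnot n1
  have k2 := T.relnot n2
  have k3 := T.relnot n3
  have k4 := T.relnot n4
  have k5 := T.relnot n5
  have k6 := T.relnot n6
  have k7 := T.relnot n7
  simp only [D4, Bad, Cyc, Hom3, k1, k2, k3, k4, k5, k6, k7, h1, h2, h3, r1, r2, r3] at *
  clear k1 k2 k3 k4 k5 k6 k7 hG hF
  grind

/-- `v` disagrees on `x ∼ α`. -/
theorem L2a (T : Tournament V) {S F : Set V} {e} (hG : T.Good S e) {v α x y w : V}
    (hv : v ∉ S) (hα : α ∈ S) (hF : T.Fat F α) (hx : x ∈ S) (hy : y ∈ S) (hw : w ∈ S)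
    (vF : v ∈ F) (xF : x ∈ F) (yF : y ∈ F) (wF : w ∈ F)
    (hw' : T.Cyc x y w ∨ T.Cyc x w y)
    (exy : ¬ e x y) (eα : e x α)
    (hd : ¬ (T.rel v x ↔ T.rel v α)) :
    (T.rel v y ↔ (T.rel x y ↔ (T.rel v α ↔ T.rel x α))) := by
  have exw : ¬ e x w := by
    intro h
    rcases hw' with ⟨h1, h2, h3⟩ | ⟨h1, h2, h3⟩
    · exact T.asymm _ _ h2 (hG.mod x hx w hw y hy h exy h1)
    · exact T.asymm _ _ h2 (hG.mod' x hx w hw y hy h exy h3)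
  have n1 : v ≠ α := by rintro rfl; exact hv hα
  have n2 : v ≠ w := by rintro rfl; exact hv hw
  have n3 : v ≠ x := by rintro rfl; exact hv hx
  have n4 : v ≠ y := by rintro rfl; exact hv hy
  have n5 : α ≠ x := by rintro rfl; exact hF.1 xF
  have n6 : α ≠ y := by rintro rfl; exact hF.1 yF
  have n7 : α ≠ w := by rintro rfl; exact hF.1 wF
  have n8 : x ≠ y := by rintro rfl; exact exy (hG.rfl' _ hx)
  have n9 : x ≠ w := by rintro rfl; exact exw (hG.rfl' _ hx)
  have m1 : T.rel α y ↔ T.rel x y :=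
    ⟨hG.mod α hα x hx y hy (hG.sym _ hx _ hα eα)
      (fun h => exy (hG.trn _ hx _ hα _ hy eα h)), hG.mod x hx α hα y hy eα exy⟩
  have m2 : T.rel α w ↔ T.rel x w :=
    ⟨hG.mod α hα x hx w hw (hG.sym _ hx _ hα eα)
      (fun h => exw (hG.trn _ hx _ hα _ hw eα h)), hG.mod x hx α hα w hw eα exw⟩
  have a1 := hF.2 v vF x xF y yF
  have a2 := hF.2 v vF x xF w wF
  have a3 := hF.2 v vF y yF x xF
  have a4 := hF.2 v vF y yF w wF
  have a5 := hF.2 v vF w wF x xF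
  have a6 := hF.2 v vF w wF y yF
  have a7 := hF.2 x xF y yF v vF
  have a8 := hF.2 x xF y yF w wF
  have a9 := hF.2 x xF w wF v vF
  have a10 := hF.2 x xF w wF y yF
  have a11 := hF.2 y yF w wF v vF
  have a12 := hF.2 y yF w wF x xF
  have k1 := T.relnot n1
  have k2 := T.relnot n2
  have k3 := T.relnot n3
  have k4 := T.relnot n4
  have k5 := T.relnot n5
  have k6 := T.relnot n6
  have k7 := T.relnot n7
  have k8 := T.relnot n8
  have k9 := T.relnot n9
  have k10 := T.asymm w y
  have k11 := T.asymm y w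
  simp only [D4, Bad, Cyc, Hom3] at *
  clear hG hF
  grind

theorem L2 (T : Tournament V) {v x y z : V} (P : Prop) (n1 : v ≠ x) (n2 : v ≠ y)
    (n3 : v ≠ z) (n4 : x ≠ y) (n5 : x ≠ z) (n6 : y ≠ z)
    (h1 : T.rel v y ↔ (T.rel x y ↔ P)) (h2 : T.rel v z ↔ (T.rel x z ↔ P)) : ¬ T.D4 v x y z := by
  have k1 := T.relnot n1
  have k2 := T.relnot n2
  have k3 := T.relnot n3
  have k4 := T.relnot n4
  have k5 := T.relnot n5
  have k6 := T.relnot n6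
  simp only [D4, Bad, Cyc, Hom3] at *
  grind

/-- if four vertices of `S` in distinct classes plus `v`. -/
theorem L4 (T : Tournament V) {v x y z α : V} (n1 : v ≠ x) (n2 : v ≠ y)
    (n3 : v ≠ z) (n4 : x ≠ y) (n5 : x ≠ z) (n6 : y ≠ z) (n7 : α ≠ v) (n8 : α ≠ x) (n9 : α ≠ y)
    (n10 : α ≠ z) (h : ¬ T.D4 α x y z) (h1 : T.D4 v x y z) :
    T.D4 v α x y ∨ T.D4 v α x z ∨ T.D4 v α y z := by
  have k1 := T.relnot n1
  have k2 := T.relnot n2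
  have k3 := T.relnot n3
  have k4 := T.relnot n4
  have k5 := T.relnot n5
  have k6 := T.relnot n6
  have k7 := T.relnot n7
  have k8 := T.relnot n8
  have k9 := T.relnot n9
  have k10 := T.relnot n10
  simp only [D4, Bad, Cyc, Hom3, k1, k2, k3, k4, k5, k6, k7, k8, k9, k10] at *
  clear k1 k2 k3 k4 k5 k6 k7 k8 k9 k10
  generalize T.rel v x = a1 at *
  generalize T.rel v y = a2 at *
  generalize T.rel v z = a3 at *
  generalize T.rel x y = a4 at *
  generalize T.rel x z = a5 at *
  generalize T.rel y z = a6 at *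
  generalize T.rel α v = a7 at *
  generalize T.rel α x = a8 at *
  generalize T.rel α y = a9 at *
  generalize T.rel α z = a10 at *
  clear n1 n2 n3 n4 n5 n6 n7 n8 n9 n10 T
  rcases h1 with h1 | h1 | h1 | h1 <;>
    obtain ⟨⟨t1, t2, t3⟩ | ⟨t1, t2, t3⟩, ⟨h1, h2, h3⟩ | ⟨h1, h2, h3⟩⟩ := h1 <;>
    simp only [t1, t2, t3, h1, h2, h3, not_true, not_false_iff, true_and, and_true, false_and,
      and_false, or_true, true_or, or_false, false_or, not_not] at h ⊢ <;>
    by_cases a7 <;> by_cases a8 <;> by_cases a9 <;> by_cases a10 <;> simp_all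

theorem Good.bad {T : Tournament V} {S : Set V} {e} (hG : T.Good S e) {x p q s : V}
    (hx : x ∈ S) (hp : p ∈ S) (hq : q ∈ S) (hs : s ∈ S) (h : T.Bad x p q s) : e p q ∨ e p s := by
  obtain ⟨⟨t1, t2, t3⟩ | ⟨t1, t2, t3⟩, ⟨h1, h2, h3⟩ | ⟨h1, h2, h3⟩⟩ := h
  · exact Or.inl (hG.lt _ hx _ hp _ hq _ hs t1 t2 t3 h1 h2 h3)
  · exact Or.inl (hG.lt' _ hx _ hp _ hq _ hs t1 t2 t3 h1 h2 h3)
  · exact Or.inr (hG.lt _ hx _ hp _ hs _ hq t1 t2 t3 h1 h3 h2)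
  · exact Or.inr (hG.lt' _ hx _ hp _ hs _ hq t1 t2 t3 h1 h3 h2)

theorem Good.noD4 {T : Tournament V} {S : Set V} {e} (hG : T.Good S e) {a x y z : V}
    (ha : a ∈ S) (hx : x ∈ S) (hy : y ∈ S) (hz : z ∈ S)
    (e1 : ¬ e a x) (e2 : ¬ e a y) (e3 : ¬ e a z) (e4 : ¬ e x y) (e5 : ¬ e x z) :
    ¬ T.D4 a x y z := by
  rintro (h | h | h | h)
  · have := hG.bad ha hx hy hz h; tauto
  · have := hG.bad hx ha hy hz h; tauto
  · have := hG.bad hy ha hx hz h; tauto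
  · have := hG.bad hz ha hx hy h; tauto

/-- D4 symmetric -/
theorem D4.rot {T : Tournament V} {v x y z : V} (h : T.D4 v x y z) : T.D4 v y z x := by
  rcases h with h1 | h1 | h1 | h1 <;>
    obtain ⟨⟨t1, t2, t3⟩ | ⟨t1, t2, t3⟩, ⟨h1, h2, h3⟩ | ⟨h1, h2, h3⟩⟩ := h1 <;>
    simp [D4, Bad, Cyc, Hom3, t1, t2, t3, h1, h2, h3]
theorem D4.swap {T : Tournament V} {v x y z : V} (h : T.D4 v x y z) : T.D4 v x z y := by
  rcases h with h1 | h1 | h1 | h1 <;>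
    obtain ⟨⟨t1, t2, t3⟩ | ⟨t1, t2, t3⟩, ⟨h1, h2, h3⟩ | ⟨h1, h2, h3⟩⟩ := h1 <;>
    simp [D4, Bad, Cyc, Hom3, t1, t2, t3, h1, h2, h3]

theorem Good.ex2 {T : Tournament V} {S : Set V} {e} (hG : T.Good S e) {x y : V}
    (hx : x ∈ S) (hy : y ∈ S) (h : ¬ e x y) : ∃ w ∈ S, T.Cyc x y w ∨ T.Cyc x w y := by
  have n : x ≠ y := by rintro rfl; exact h (hG.rfl' _ hx)
  rcases T.total x y n with h1 | h1
  · obtain ⟨w, hw, h2, h3⟩ := hG.ex x hx y hy h1 h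
    exact ⟨w, hw, Or.inl ⟨h1, h2, h3⟩⟩
  · obtain ⟨w, hw, h2, h3⟩ := hG.ex y hy x hx h1 (fun h' => h (hG.sym _ hy _ hx h'))
    exact ⟨w, hw, Or.inr ⟨h2, h3, h1⟩⟩

theorem L3' (T : Tournament V) {S F : Set V} {e} (hG : T.Good S e) {v α q s w : V}
    (hv : v ∉ S) (hα : α ∈ S) (hF : T.Fat F α) (hq : q ∈ S) (hs : s ∈ S) (hw : w ∈ S)
    (vF : v ∈ F) (qF : q ∈ F) (sF : s ∈ F) (wF : w ∈ F)
    (hqs : ¬ e q s) (h : T.Cyc q s w ∨ T.Cyc q w s) :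
    ¬ T.D4 v α q s := by
  rcases h with ⟨h1, h2, h3⟩ | ⟨h1, h2, h3⟩
  · exact T.L3 hG hv hα hF hq hs hw vF qF sF wF hqs h1 h2 h3
  · intro h
    exact T.L3 hG hv hα hF hs hq hw vF sF qF wF (fun h' => hqs (hG.sym _ hs _ hq h')) h3 h1 h2 h.swap

/-- the case where `α ∼ x` -/
theorem L5 (T : Tournament V) {S F : Set V} {e} (hG : T.Good S e) {v α x y z w1 w2 w3 : V}
    (hv : v ∉ S) (hα : α ∈ S) (hF : T.Fat F α) (hx : x ∈ S) (hy : y ∈ S) (hz : z ∈ S)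
    (hw1 : w1 ∈ S) (hw2 : w2 ∈ S) (hw3 : w3 ∈ S)
    (vF : v ∈ F) (xF : x ∈ F) (yF : y ∈ F) (zF : z ∈ F) (w1F : w1 ∈ F) (w2F : w2 ∈ F)
    (w3F : w3 ∈ F)
    (t1 : T.Cyc x y w1 ∨ T.Cyc x w1 y) (t2 : T.Cyc x z w2 ∨ T.Cyc x w2 z)
    (t3 : T.Cyc y z w3 ∨ T.Cyc y w3 z)
    (exy : ¬ e x y) (exz : ¬ e x z) (eyz : ¬ e y z) (eα : e x α) : ¬ T.D4 v x y z := by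
  have n1 : v ≠ α := by rintro rfl; exact hv hα
  have n3 : v ≠ x := by rintro rfl; exact hv hx
  have n4 : v ≠ y := by rintro rfl; exact hv hy
  have n5 : v ≠ z := by rintro rfl; exact hv hz
  have n6 : x ≠ y := by rintro rfl; exact exy (hG.rfl' _ hx)
  have n7 : x ≠ z := by rintro rfl; exact exz (hG.rfl' _ hx)
  have n8 : y ≠ z := by rintro rfl; exact eyz (hG.rfl' _ hy)
  by_cases hd : T.rel v x ↔ T.rel v α
  · intro h
    apply T.L3' hG hv hα hF hy hz hw3 vF yF zF w3F eyz t3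
    have m : ∀ y ∈ S, ¬ e x y → ((T.rel α y ↔ T.rel x y) ∧ (T.rel y α ↔ T.rel y x)) := by
      intro y hy exy
      have := hG.sym _ hx _ hα eα
      have h2 : ¬ e α y := (fun h => exy (hG.trn _ hx _ hα _ hy eα h))
      exact ⟨⟨hG.mod α hα x hx y hy this h2, hG.mod x hx α hα y hy eα exy⟩,
        ⟨hG.mod' α hα x hx y hy this h2, hG.mod' x hx α hα y hy eα exy⟩⟩
    have hd' : T.rel x v ↔ T.rel α v := by rw [T.relnot n1, T.relnot n3, hd]
    simp only [D4, Bad, Cyc, Hom3, hd, hd', (m y hy exy).1, (m z hz exz).1, (m y hy exy).2,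
      (m z hz exz).2] at *
    exact h
  · exact T.L2 _ n3 n4 n5 n6 n7 n8
      (T.L2a hG hv hα hF hx hy hw1 vF xF yF w1F t1 exy eα hd)
      (T.L2a hG hv hα hF hx hz hw2 vF xF zF w2F t2 exz eα hd)

theorem cyc2 (T : Tournament V) {x y w : V} (h : T.Cyc x y w ∨ T.Cyc x w y) :
    T.Cyc y x w ∨ T.Cyc y w x := by
  simp only [Cyc] at *; tauto

/-- Step 1: no transversal `D4` containing `v`. -/
theorem step1 (T : Tournament V) {S : Set V} {e} (hG : T.Good S e) {v x y z : V}
    (hfat : ∀ F : List V, F.length ≤ 7 → ∃ α ∈ S, T.Fat {x | x ∈ F} α)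
    (hv : v ∉ S) (hx : x ∈ S) (hy : y ∈ S) (hz : z ∈ S)
    (exy : ¬ e x y) (exz : ¬ e x z) (eyz : ¬ e y z) : ¬ T.D4 v x y z := by
  obtain ⟨w1, hw1, t1⟩ := hG.ex2 hx hy exy
  obtain ⟨w2, hw2, t2⟩ := hG.ex2 hx hz exz
  obtain ⟨w3, hw3, t3⟩ := hG.ex2 hy hz eyz
  obtain ⟨α, hα, hF⟩ := hfat [v, x, y, z, w1, w2, w3] (by simp)
  generalize hFF : {q | q ∈ [v, x, y, z, w1, w2, w3]} = F at hF
  have vF : v ∈ F := by rw [← hFF]; simp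
  have xF : x ∈ F := by rw [← hFF]; simp
  have yF : y ∈ F := by rw [← hFF]; simp
  have zF : z ∈ F := by rw [← hFF]; simp
  have w1F : w1 ∈ F := by rw [← hFF]; simp
  have w2F : w2 ∈ F := by rw [← hFF]; simp
  have w3F : w3 ∈ F := by rw [← hFF]; simp
  clear hFF
  have eyx : ¬ e y x := fun h => exy (hG.sym _ hy _ hx h)
  have ezx : ¬ e z x := fun h => exz (hG.sym _ hz _ hx h)
  have ezy : ¬ e z y := fun h => eyz (hG.sym _ hz _ hy h)
  by_cases c1 : e x α
  · exact T.L5 hG hv hα hF hx hy hz hw1 hw2 hw3 vF xF yF zF w1F w2F w3F t1 t2 t3 exy exz eyz c1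
  by_cases c2 : e y α
  · exact fun h => T.L5 hG hv hα hF hy hz hx hw3 hw1 hw2 vF yF zF xF w3F w1F w2F t3
      (T.cyc2 t1) (T.cyc2 t2) eyz eyx ezx c2 h.rot
  by_cases c3 : e z α
  · exact fun h => T.L5 hG hv hα hF hz hx hy hw2 hw3 hw1 vF zF xF yF w2F w3F w1F (T.cyc2 t2)
      (T.cyc2 t3) t1 ezx ezy exy c3 h.rot.rot
  have c1' : ¬ e α x := fun h => c1 (hG.sym _ hα _ hx h)
  have c2' : ¬ e α y := fun h => c2 (hG.sym _ hα _ hy h)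
  have n1 : v ≠ α := by rintro rfl; exact hv hα
  have n3 : v ≠ x := by rintro rfl; exact hv hx
  have n4 : v ≠ y := by rintro rfl; exact hv hy
  have n5 : v ≠ z := by rintro rfl; exact hv hz
  have n6 : x ≠ y := by rintro rfl; exact exy (hG.rfl' _ hx)
  have n7 : x ≠ z := by rintro rfl; exact exz (hG.rfl' _ hx)
  have n8 : y ≠ z := by rintro rfl; exact eyz (hG.rfl' _ hy)
  have n9 : α ≠ x := by rintro rfl; exact c1 (hG.rfl' _ hx)
  have n10 : α ≠ y := by rintro rfl; exact c2 (hG.rfl' _ hy)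
  have n11 : α ≠ z := by rintro rfl; exact c3 (hG.rfl' _ hz)
  have := hG.noD4 hα hx hy hz c1' c2' (fun h => c3 (hG.sym _ hα _ hz h)) exy exz
  intro h
  rcases T.L4 n3 n4 n5 n6 n7 n8 n1.symm n9 n10 n11 this h with h | h | h
  · exact T.L3' hG hv hα hF hx hy hw1 vF xF yF w1F exy t1 h
  · exact T.L3' hG hv hα hF hx hz hw2 vF xF zF w2F exz t2 h
  · exact T.L3' hG hv hα hF hy hz hw3 vF yF zF w3F eyz t3 h

/-- Step 1': the antitwin case. -/
theorem step1' (T : Tournament V) {S : Set V} {e} (hG : T.Good S e) {v j u p : V}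
    (hfat : ∀ F : List V, F.length ≤ 7 → ∃ α ∈ S, T.Fat {x | x ∈ F} α)
    (hv : v ∉ S) (hj : j ∈ S) (hu : u ∈ S) (hp : p ∈ S) (eu : e j u) (ep : e j p)
    (hanti : ∀ x ∈ S, ¬ e j x → (T.rel v x ↔ T.rel x j))
    (h1 : T.rel u v) (h2 : T.rel v p) : T.rel p u := by
  by_contra hup
  have nup : p ≠ u := by rintro rfl; exact T.asymm _ _ h1 h2
  have h3 : T.rel u p := (T.relnot nup).2 hup
  have : ∃ y ∈ S, ¬ e j y := by
    by_contra hh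
    push Not at hh
    obtain ⟨x, hx, y, hy, h⟩ := hG.nt
    exact h (hG.trn _ hx _ hj _ hy (hG.sym _ hj _ hx (hh x hx)) (hh y hy))
  obtain ⟨y, hy, ejy⟩ := this
  obtain ⟨w, hw, t⟩ := hG.ex2 hj hy ejy
  have ejw : ¬ e j w := by
    intro h
    rcases t with ⟨h1, h2, h3⟩ | ⟨h1, h2, h3⟩
    · exact T.asymm _ _ h2 (hG.mod j hj w hw y hy h ejy h1)
    · exact T.asymm _ _ h2 (hG.mod' j hj w hw y hy h ejy h3)
  obtain ⟨α, hα, hF⟩ := hfat [v, u, p, y, w] (by simp)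
  generalize hFF : {x | x ∈ [v, u, p, y, w]} = F at hF
  have vF : v ∈ F := by rw [← hFF]; simp
  have uF : u ∈ F := by rw [← hFF]; simp
  have pF : p ∈ F := by rw [← hFF]; simp
  have yF : y ∈ F := by rw [← hFF]; simp
  have wF : w ∈ F := by rw [← hFF]; simp
  clear hFF
  have m : ∀ x ∈ S, ¬ e j x → ∀ i ∈ S, e j i → ((T.rel j x ↔ T.rel i x) ∧ (T.rel x j ↔ T.rel x i)) := by
    intro x hx ejx i hi eji
    have eij := hG.sym _ hj _ hi eji
    have h2 : ¬ e i x := fun h => ejx (hG.trn _ hj _ hi _ hx eji h)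
    exact ⟨⟨hG.mod j hj i hi x hx eji ejx, hG.mod i hi j hj x hx eij h2⟩,
      ⟨hG.mod' j hj i hi x hx eji ejx, hG.mod' i hi j hj x hx eij h2⟩⟩
  have n1 : v ≠ α := by rintro rfl; exact hv hα
  have n2 : v ≠ w := by rintro rfl; exact hv hw
  have n3 : v ≠ y := by rintro rfl; exact hv hy
  have n4 : α ≠ u := by rintro rfl; exact hF.1 uF
  have n5 : α ≠ p := by rintro rfl; exact hF.1 pF
  have k1 := T.relnot n1
  have k2 := T.relnot n2
  have k3 := T.relnot n3
  have k4 := T.relnot n4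
  have k5 := T.relnot n5
  have r1 := T.asymm _ _ h1
  have r2 := T.asymm _ _ h2
  have my := m y hy ejy
  have mw := m w hw ejw
  have myu := my u hu eu
  have myp := my p hp ep
  have mwu := mw u hu eu
  have mwp := mw p hp ep
  have av := hanti y hy ejy
  have aw := hanti w hw ejw
  have as := T.asymm
  have a1 := hF.2 v vF y yF u uF
  have a2 := hF.2 v vF w wF u uF
  have a3 := hF.2 v vF y yF p pF
  have a4 := hF.2 v vF w wF p pF
  have a5 := hF.2 u uF p pF y yF
  have a6 := hF.2 u uF p pF w wF
  have a7 := hF.2 v vF p pF u uF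
  have a8 := hF.2 v vF u uF p pF
  have a9 := hF.2 u uF p pF v vF
  have a10 := hF.2 u uF v vF y yF
  have a11 := hF.2 u uF v vF w wF
  have a12 := hF.2 p pF v vF y yF
  have a13 := hF.2 p pF v vF w wF
  by_cases c : e j α
  · have myα := my α hα c
    have mwα := mw α hα c
    simp only [Bad, Cyc, Hom3] at *
    clear m my mw hfat hF hanti hG
    grind
  · have mα := m α hα c
    have mau := mα u hu eu
    have map := mα p hp ep
    have aa := hanti α hα c
    simp only [Bad, Cyc, Hom3] at *
    clear m my mw hfat hF hanti hG
    grind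

theorem Good.mm {T : Tournament V} {S : Set V} {e} (hG : T.Good S e) {j i x : V}
    (hj : j ∈ S) (hi : i ∈ S) (hx : x ∈ S) (eji : e j i) (ejx : ¬ e j x) :
    ((T.rel j x ↔ T.rel i x) ∧ (T.rel x j ↔ T.rel x i)) ∧ ¬ e i x := by
  have eij := hG.sym _ hj _ hi eji
  have h2 : ¬ e i x := fun h => ejx (hG.trn _ hj _ hi _ hx eji h)
  exact ⟨⟨⟨hG.mod j hj i hi x hx eji ejx, hG.mod i hi j hj x hx eij h2⟩,
    ⟨hG.mod' j hj i hi x hx eji ejx, hG.mod' i hi j hj x hx eij h2⟩⟩, h2⟩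

theorem Good.other {T : Tournament V} {S : Set V} {e} (hG : T.Good S e) {j : V}
    (hj : j ∈ S) : ∃ y ∈ S, ¬ e j y := by
  by_contra hh
  push Not at hh
  obtain ⟨x, hx, y, hy, h⟩ := hG.nt
  exact h (hG.trn _ hx _ hj _ hy (hG.sym _ hj _ hx (hh x hx)) (hh y hy))

/-- triangle with one inequivalent pair is transversal -/
theorem Good.tri {T : Tournament V} {S : Set V} {e} (hG : T.Good S e) {x y z : V}
    (hx : x ∈ S) (hy : y ∈ S) (hz : z ∈ S) (h1 : T.rel x y) (h2 : T.rel y z) (h3 : T.rel z x)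
    (h : ¬ e x y) : ¬ e y z ∧ ¬ e z x := by
  constructor
  · intro h'
    have h'' := hG.sym _ hy _ hz h'
    have := hG.mod' y hy z hz x hx h' (fun k => h (hG.sym _ hy _ hx k)) h1
    exact T.asymm _ _ this h3
  · intro h'
    have h'' := hG.sym _ hz _ hx h'
    have := hG.mod x hx z hz y hy h'' h h1
    exact T.asymm _ _ this h2

theorem Good.ex3 {T : Tournament V} {S : Set V} {e} (hG : T.Good S e) {j : V}
    (hj : j ∈ S) : ∃ x ∈ S, ∃ z ∈ S, T.rel j x ∧ T.rel x z ∧ T.rel z j ∧ ¬ e j x ∧ ¬ e j z ∧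
      ¬ e x z := by
  obtain ⟨y, hy, h⟩ := hG.other hj
  obtain ⟨w, hw, ⟨h1, h2, h3⟩ | ⟨h1, h2, h3⟩⟩ := hG.ex2 hj hy h
  · obtain ⟨h4, h5⟩ := hG.tri hj hy hw h1 h2 h3 h
    exact ⟨y, hy, w, hw, h1, h2, h3, h, fun k => h5 (hG.sym _ hj _ hw k), h4⟩
  · have h' : ¬ e y j := fun k => h (hG.sym _ hy _ hj k)
    obtain ⟨h4, h5⟩ := hG.tri hy hj hw h3 h1 h2 h'
    exact ⟨w, hw, y, hy, h1, h2, h3, h4, h, h5⟩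

/-- Step 2, mixed case. -/
theorem mixed (T : Tournament V) {S : Set V} {e} (hG : T.Good S e) {v j u p : V} (hv : v ∉ S)
    (hD : ∀ x ∈ S, ∀ y ∈ S, ∀ z ∈ S, ¬ e x y → ¬ e x z → ¬ e y z → ¬ T.D4 v x y z)
    (hj : j ∈ S) (hu : u ∈ S) (hp : p ∈ S) (eu : e j u) (ep : e j p)
    (h1 : T.rel u v) (h2 : T.rel v p) :
    (∀ x ∈ S, ¬ e j x → (T.rel v x ↔ T.rel j x)) ∨ (∀ x ∈ S, ¬ e j x → (T.rel v x ↔ T.rel x j)) := by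
  have M : ∀ x ∈ S, ∀ y ∈ S, ¬ e j x → ¬ e j y → ¬ e x y → T.rel x y →
      ((T.rel j x ↔ T.rel j y) → (T.rel v x ↔ T.rel v y)) ∧
      (T.rel j x → T.rel y j → (T.rel v x ↔ ¬ T.rel v y)) := by
    intro x hx y hy ex ey exy hxy
    obtain ⟨xu, xu'⟩ := hG.mm hj hu hx eu ex
    obtain ⟨xp, xp'⟩ := hG.mm hj hp hx ep ex
    obtain ⟨yu, yu'⟩ := hG.mm hj hu hy eu ey
    obtain ⟨yp, yp'⟩ := hG.mm hj hp hy ep ey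
    have d1 := hD u hu x hx y hy xu' yu' exy
    have d2 := hD p hp x hx y hy xp' yp' exy
    have n1 : v ≠ x := by rintro rfl; exact hv hx
    have n2 : v ≠ y := by rintro rfl; exact hv hy
    have n3 : j ≠ x := by rintro rfl; exact ex (hG.rfl' _ hx)
    have n4 : j ≠ y := by rintro rfl; exact ey (hG.rfl' _ hy)
    have k1 := T.relnot n1
    have k2 := T.relnot n2
    have k3 := T.relnot n3
    have k4 := T.relnot n4
    simp only [D4, Bad, Cyc, Hom3, k1, k2, ← xu.1, ← xu.2, ← xp.1, ← xp.2, ← yu.1, ← yu.2, ← yp.1,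
      ← yp.2, k3, k4, h1, h2, hxy] at d1 d2 ⊢
    clear hG hD
    grind
  obtain ⟨x0, hx0, z0, hz0, g1, g2, g3, g4, g5, g6⟩ := hG.ex3 hj
  have K : ∀ x ∈ S, ¬ e j x → ∃ z ∈ S, ¬ e j z ∧ ¬ e x z ∧
      ((T.rel j x ∧ T.rel x z ∧ T.rel z j) ∨ (T.rel j z ∧ T.rel z x ∧ T.rel x j)) := by
    intro x hx ex
    have n3 : j ≠ x := by rintro rfl; exact ex (hG.rfl' _ hx)
    have ex' : ¬ e x j := fun k => ex (hG.sym _ hx _ hj k)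
    rcases T.total _ _ n3 with h | h
    · obtain ⟨z, hz, q1, q2⟩ := hG.ex _ hj _ hx h ex
      obtain ⟨h4, h5⟩ := hG.tri hj hx hz h q1 q2 ex
      exact ⟨z, hz, fun k => h5 (hG.sym _ hj _ hz k), h4, Or.inl ⟨h, q1, q2⟩⟩
    · obtain ⟨z, hz, q1, q2⟩ := hG.ex _ hx _ hj h ex'
      obtain ⟨h4, h5⟩ := hG.tri hx hj hz h q1 q2 ex'
      exact ⟨z, hz, h4, fun k => h5 (hG.sym _ hx _ hz k), Or.inr ⟨q1, q2, h⟩⟩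
  have C : ∀ x ∈ S, ∀ y ∈ S, ¬ e j x → ¬ e j y → (T.rel j x ↔ T.rel j y) →
      (T.rel v x ↔ T.rel v y) := by
    intro x hx y hy ex ey hxy
    by_cases exy : e x y
    · obtain ⟨z, hz, ez, exz, h⟩ := K x hx ex
      obtain ⟨m, eyz⟩ := hG.mm hx hy hz exy exz
      rcases h with ⟨q1, q2, q3⟩ | ⟨q1, q2, q3⟩
      · have a := (M x hx z hz ex ez exz q2).2 q1 q3
        have b := (M y hy z hz ey ez eyz (m.1.1 q2)).2 (hxy.1 q1) q3
        rw [a, b]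
      · have exz' : ¬ e z x := fun k => exz (hG.sym _ hz _ hx k)
        have eyz' : ¬ e z y := fun k => eyz (hG.sym _ hz _ hy k)
        have n4 : j ≠ y := by rintro rfl; exact ey (hG.rfl' _ hy)
        have q4 : T.rel y j := by
          rw [T.relnot n4, ← hxy]; exact T.asymm _ _ q3
        have a := (M z hz x hx ez ex exz' q2).2 q1 q3
        have b := (M z hz y hy ez ey eyz' (m.2.1 q2)).2 q1 q4
        tauto
    · have exy' : ¬ e y x := fun k => exy (hG.sym _ hy _ hx k)
      have n : x ≠ y := by rintro rfl; exact exy (hG.rfl' _ hx)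
      rcases T.total _ _ n with h | h
      · exact (M x hx y hy ex ey exy h).1 hxy
      · exact ((M y hy x hx ey ex exy' h).1 hxy.symm).symm
  have B := (M x0 hx0 z0 hz0 g4 g5 g6 g2).2 g1 g3
  have g3' := T.asymm _ _ g3
  have R : ∀ x ∈ S, ¬ e j x → (T.rel x j ↔ ¬ T.rel j x) := fun x hx ex =>
    T.relnot (by rintro rfl; exact ex (hG.rfl' _ hx))
  by_cases hh : T.rel v x0
  · left
    intro x hx ex
    have c1 := C x hx x0 hx0 ex g4
    have c2 := C x hx z0 hz0 ex g5
    tauto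
  · right
    intro x hx ex
    rw [R x hx ex]
    have c1 := C x hx x0 hx0 ex g4
    have c2 := C x hx z0 hz0 ex g5
    tauto

theorem exmin [Finite V] (N : Set V) (R : V → V → Prop) (hN : N.Nonempty)
    (h1 : ∀ a ∈ N, ¬ R a a) (h2 : ∀ a ∈ N, ∀ b ∈ N, ∀ c ∈ N, R a b → R b c → R a c) :
    ∃ m ∈ N, ∀ a ∈ N, ¬ R a m := by
  let r : N → N → Prop := fun a b => R a b
  haveI : IsTrans N r := ⟨fun a b c => h2 a a.2 b b.2 c c.2⟩
  haveI : Std.Irrefl r := ⟨fun a => h1 a a.2⟩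
  have wf : WellFounded r := Finite.wellFounded_of_trans_of_irrefl r
  obtain ⟨m, _, hm⟩ := wf.has_min Set.univ ⟨⟨hN.some, hN.some_mem⟩, trivial⟩
  exact ⟨m, m.2, fun a ha => hm ⟨a, ha⟩ trivial⟩

/-- Step 2, unmixed case. -/
theorem unmixed [Finite V] (T : Tournament V) {S : Set V} {e} (hG : T.Good S e) {v : V} (hv : v ∉ S)
    (hD : ∀ x ∈ S, ∀ y ∈ S, ∀ z ∈ S, ¬ e x y → ¬ e x z → ¬ e y z → ¬ T.D4 v x y z)
    (hm : ∀ x ∈ S, ∀ y ∈ S, e x y → (T.rel v x ↔ T.rel v y)) :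
    ∃ j ∈ S, ∀ x ∈ S, ¬ e j x → (T.rel v x ↔ T.rel j x) := by
  have R : ∀ x ∈ S, (T.rel x v ↔ ¬ T.rel v x) := fun x hx =>
    T.relnot (by rintro rfl; exact hv hx)
  have R2 : ∀ x ∈ S, ∀ y ∈ S, ¬ e x y → (T.rel y x ↔ ¬ T.rel x y) := fun x hx y hy ex =>
    T.relnot (by rintro rfl; exact ex (hG.rfl' _ hx))
  have sy : ∀ x ∈ S, ∀ y ∈ S, ¬ e x y → ¬ e y x := fun x hx y hy h k => h (hG.sym _ hy _ hx k)
  obtain ⟨s0, hs0, _⟩ := hG.nt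
  obtain ⟨x0, hx0, z0, hz0, g1, g2, g3, g4, g5, g6⟩ := hG.ex3 hs0
  have D0 := hD s0 hs0 x0 hx0 z0 hz0 g4 g5 g6
  have N1 : {x | x ∈ S ∧ T.rel v x}.Nonempty := by
    by_contra hh
    rw [Set.not_nonempty_iff_eq_empty, Set.eq_empty_iff_forall_notMem] at hh
    refine D0 (Or.inl ⟨Or.inl ⟨g1, g2, g3⟩, Or.inr ?_⟩)
    simp only [Set.mem_setOf_eq, not_and] at hh
    exact ⟨(R _ hs0).2 (hh _ hs0), (R _ hx0).2 (hh _ hx0), (R _ hz0).2 (hh _ hz0)⟩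
  have N2 : {x | x ∈ S ∧ T.rel x v}.Nonempty := by
    by_contra hh
    rw [Set.not_nonempty_iff_eq_empty, Set.eq_empty_iff_forall_notMem] at hh
    refine D0 (Or.inl ⟨Or.inl ⟨g1, g2, g3⟩, Or.inl ?_⟩)
    simp only [Set.mem_setOf_eq, not_and] at hh
    have hh' : ∀ x ∈ S, T.rel v x := fun x hx => by
      have := hh x hx; rw [R x hx] at this; exact not_not.1 this
    exact ⟨hh' _ hs0, hh' _ hx0, hh' _ hz0⟩
  have tr : ∀ a ∈ S, ∀ b ∈ S, ∀ c ∈ S, T.rel a b → T.rel b c → ¬ e a b → ¬ e b c →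
      T.Hom3 v a b c → (T.rel a c ∧ ¬ e a c) := by
    intro a ha b hb c hc h1 h2 e1 e2 hom
    have e3 : ¬ e a c := by
      intro k
      exact T.asymm _ _ ((hG.mm ha hc hb k e1).1.1.1 h1) h2
    refine ⟨?_, e3⟩
    by_contra h3
    exact hD a ha b hb c hc e1 e3 e2 (Or.inl ⟨Or.inl ⟨h1, h2, (R2 a ha c hc e3).2 h3⟩, hom⟩)
  obtain ⟨j, ⟨hj, vj⟩, jm⟩ := exmin _ (fun a b => T.rel a b ∧ ¬ e a b) N1
    (fun a _ h => T.irr _ h.1) (by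
      rintro a ⟨ha, ha'⟩ b ⟨hb, hb'⟩ c ⟨hc, hc'⟩ ⟨h1, e1⟩ ⟨h2, e2⟩
      exact tr a ha b hb c hc h1 h2 e1 e2 (Or.inl ⟨ha', hb', hc'⟩))
  obtain ⟨j', ⟨hj', vj'⟩, jm'⟩ := exmin _ (fun a b => T.rel b a ∧ ¬ e b a) N2
    (fun a _ h => T.irr _ h.1) (by
      rintro a ⟨ha, ha'⟩ b ⟨hb, hb'⟩ c ⟨hc, hc'⟩ ⟨h1, e1⟩ ⟨h2, e2⟩
      exact tr c hc b hb a ha h2 h1 e2 e1 (Or.inr ⟨hc', hb', ha'⟩))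
  have J : ∀ a ∈ S, T.rel v a → ¬ e j a → T.rel j a := by
    intro a ha va k
    have := jm a ⟨ha, va⟩
    by_contra h
    exact this ⟨(R2 _ hj _ ha k).2 h, sy _ hj _ ha k⟩
  have J' : ∀ a ∈ S, T.rel a v → ¬ e j' a → T.rel a j' := by
    intro a ha va k
    have := jm' a ⟨ha, va⟩
    by_contra h
    rw [R2 _ hj' _ ha k] at h
    exact this ⟨not_not.1 h, k⟩
  clear jm jm'
  by_contra hcon
  push Not at hcon
  obtain ⟨a, ha, eja, h⟩ := hcon j hj
  have ja : T.rel j a ∧ T.rel a v := by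
    have := J a ha
    have := R a ha
    grind
  obtain ⟨b, hb, ejb, h'⟩ := hcon j' hj'
  have jb : T.rel b j' ∧ T.rel v b := by
    have := J' b hb
    have := R b hb
    have := R2 _ hj' _ hb ejb
    grind
  obtain ⟨ja, av⟩ := ja
  obtain ⟨bj', vb⟩ := jb
  clear h h' hcon
  have sep : ∀ x ∈ S, ∀ y ∈ S, T.rel v x → T.rel y v → ¬ e x y := by
    intro x hx y hy h1 h2 k
    exact T.asymm _ _ h2 ((hm x hx y hy k).1 h1)
  have ejj := sep _ hj _ hj' vj vj'
  have eba := sep _ hb _ ha vb av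
  by_cases hjj : T.rel j j'
  · obtain ⟨w, hw, q1, q2⟩ := hG.ex _ hj _ hj' hjj ejj
    obtain ⟨h4, h5⟩ := hG.tri hj hj' hw hjj q1 q2 ejj
    by_cases vw : T.rel v w
    · exact T.asymm _ _ q2 (J w hw vw (sy _ hw _ hj h5))
    · exact T.asymm _ _ q1 (J' w hw ((R w hw).2 vw) h4)
  · have hjj' := (R2 _ hj _ hj' ejj).2 hjj
    have eja' : ¬ e j' a := by
      intro k
      exact T.asymm _ _ hjj' ((hG.mm hj' ha hj k (sy _ hj _ hj' ejj)).1.2.2 ja)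
    have aj' := J' a ha av eja'
    have ejb' : ¬ e j b := by
      intro k
      exact T.asymm _ _ hjj' ((hG.mm hj hb hj' k ejj).1.1.2 bj')
    have jb := J b hb vb ejb'
    by_cases hba : T.rel b a
    · obtain ⟨w, hw, q1, q2⟩ := hG.ex _ hb _ ha hba eba
      obtain ⟨h4, h5⟩ := hG.tri hb ha hw hba q1 q2 eba
      by_cases vw : T.rel v w
      · have : ¬ e j w := by
          intro k
          exact T.asymm _ _ q1 ((hG.mm hj hw ha k eja).1.1.1 ja)
        exact eba (hG.lt _ hj _ hb _ ha _ hw hba q1 q2 jb ja (J w hw vw this))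
      · have : ¬ e j' w := by
          intro k
          exact T.asymm _ _ q2 ((hG.mm hj' hw hb k ejb).1.2.1 bj')
        exact eba (hG.lt' _ hj' _ hb _ ha _ hw hba q1 q2 bj' aj' (J' w hw ((R w hw).2 vw) this))
    · have hab := (R2 _ hb _ ha eba).2 hba
      refine hD j hj a ha b hb eja ejb' (sy _ hb _ ha eba) (Or.inr (Or.inr (Or.inr ?_)))
      exact ⟨Or.inl ⟨vj, ja, av⟩, Or.inr ⟨vb, jb, hab⟩⟩

theorem mkGood (T : Tournament V) {S : Set V} {e : V → V → Prop}
    (rfl' : ∀ x ∈ S, e x x) (sym : ∀ x ∈ S, ∀ y ∈ S, e x y → e y x)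
    (trn : ∀ x ∈ S, ∀ y ∈ S, ∀ z ∈ S, e x y → e y z → e x z)
    (mod : ∀ x ∈ S, ∀ y ∈ S, ∀ z ∈ S, e x y → ¬ e x z → T.rel x z → T.rel y z)
    (nD : ∀ a ∈ S, ∀ b ∈ S, ∀ c ∈ S, ∀ d ∈ S, ¬ e a b → ¬ e a c → ¬ e a d → ¬ e b c → ¬ e b d →
      ¬ e c d → ¬ T.D4 a b c d)
    (ex : ∀ x ∈ S, ∀ y ∈ S, T.rel x y → ¬ e x y → ∃ z ∈ S, T.rel y z ∧ T.rel z x)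
    (nt : ∃ x ∈ S, ∃ y ∈ S, ¬ e x y) : T.Good S e := by
  have ne : ∀ x ∈ S, ∀ y, ¬ e x y → x ≠ y := by
    rintro x hx y h rfl
    exact h (rfl' _ hx)
  have sy : ∀ x ∈ S, ∀ y ∈ S, ¬ e x y → ¬ e y x := fun x hx y hy h k => h (sym _ hy _ hx k)
  have mod' : ∀ x ∈ S, ∀ y ∈ S, ∀ z ∈ S, e x y → ¬ e x z → T.rel z x → T.rel z y := by
    intro x hx y hy z hz h1 h2 h3
    have h4 : ¬ e y z := fun k => h2 (trn _ hx _ hy _ hz h1 k)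
    rw [T.relnot (ne _ hy _ h4)]
    intro h
    exact T.asymm _ _ h3 (mod _ hy _ hx _ hz (sym _ hx _ hy h1) h4 h)
  have tri : ∀ p ∈ S, ∀ q ∈ S, ∀ s ∈ S, T.rel p q → T.rel q s → T.rel s p → ¬ e p q →
      ¬ e q s ∧ ¬ e p s := by
    intro p hp q hq s hs h1 h2 h3 h
    refine ⟨fun k => ?_, fun k => ?_⟩
    · exact T.asymm _ _ h3 (mod' q hq s hs p hp k (sy _ hp _ hq h) h1)
    · exact T.asymm _ _ h2 (mod p hp s hs q hq k h h1)
  refine ⟨rfl', sym, trn, mod, mod', ?_, ?_, ex, nt⟩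
  · intro x hx p hp q hq s hs t1 t2 t3 h1 h2 h3
    by_contra hpq
    obtain ⟨hqs, hps⟩ := tri p hp q hq s hs t1 t2 t3 hpq
    refine nD x hx p hp q hq s hs ?_ ?_ ?_ hpq hps hqs (Or.inl ⟨Or.inl ⟨t1, t2, t3⟩, Or.inl ⟨h1, h2, h3⟩⟩)
    · exact fun k => T.asymm _ _ h3 (mod' p hp x hx s hs (sym _ hx _ hp k) hps t3)
    · exact fun k => T.asymm _ _ h1 (mod' q hq x hx p hp (sym _ hx _ hq k) (sy _ hp _ hq hpq) t1)
    · exact fun k => T.asymm _ _ h2 (mod' s hs x hx q hq (sym _ hx _ hs k) (sy _ hq _ hs hqs) t2)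
  · intro x hx p hp q hq s hs t1 t2 t3 h1 h2 h3
    by_contra hpq
    obtain ⟨hqs, hps⟩ := tri p hp q hq s hs t1 t2 t3 hpq
    refine nD x hx p hp q hq s hs ?_ ?_ ?_ hpq hps hqs (Or.inl ⟨Or.inl ⟨t1, t2, t3⟩, Or.inr ⟨h1, h2, h3⟩⟩)
    · exact fun k => T.asymm _ _ h2 (mod p hp x hx q hq (sym _ hx _ hp k) hpq t1)
    · exact fun k => T.asymm _ _ h3 (mod q hq x hx s hs (sym _ hx _ hq k) hqs t2)
    · exact fun k => T.asymm _ _ h1 (mod s hs x hx p hp (sym _ hx _ hs k) (sy _ hp _ hs hps) t3)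

theorem D4.map {T : Tournament V} {a b c d a' b' c' d' : V} (h : T.D4 a b c d)
    (k1 : T.rel a b ↔ T.rel a' b') (k2 : T.rel a c ↔ T.rel a' c') (k3 : T.rel a d ↔ T.rel a' d')
    (k4 : T.rel b c ↔ T.rel b' c') (k5 : T.rel b d ↔ T.rel b' d') (k6 : T.rel c d ↔ T.rel c' d')
    (l1 : T.rel b a ↔ T.rel b' a') (l2 : T.rel c a ↔ T.rel c' a') (l3 : T.rel d a ↔ T.rel d' a')
    (l4 : T.rel c b ↔ T.rel c' b') (l5 : T.rel d b ↔ T.rel d' b') (l6 : T.rel d c ↔ T.rel d' c') :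
    T.D4 a' b' c' d' := by
  simp only [D4, Bad, Cyc, Hom3, k1, k2, k3, k4, k5, k6, l1, l2, l3, l4, l5, l6] at h ⊢
  exact h

open Classical in
theorem twinExt (T : Tournament V) {S : Set V} {e} (hG : T.Good S e) {v j : V} (hv : v ∉ S)
    (hj : j ∈ S) (tw : ∀ x ∈ S, ¬ e j x → (T.rel v x ↔ T.rel j x)) :
    ∃ e', T.Good (insert v S) e' := by
  obtain ⟨g, hg⟩ : ∃ g : V → V, g = fun x => if x = v then j else x := ⟨_, rfl⟩
  have gv : g v = j := by simp [hg]
  have gS : ∀ x ∈ S, g x = x := by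
    intro x hx
    have : x ≠ v := by rintro rfl; exact hv hx
    simp [hg, this]
  have gm : ∀ x ∈ insert v S, g x ∈ S := by
    rintro x (rfl | hx)
    · rw [gv]; exact hj
    · rw [gS x hx]; exact hx
  have tw' : ∀ x ∈ S, ¬ e j x → (T.rel x v ↔ T.rel x j) := by
    intro x hx ex
    have n1 : v ≠ x := by rintro rfl; exact hv hx
    have n2 : j ≠ x := by rintro rfl; exact ex (hG.rfl' _ hx)
    rw [T.relnot n1, T.relnot n2, tw x hx ex]
  have gr : ∀ x ∈ insert v S, ∀ y ∈ insert v S, ¬ e (g x) (g y) →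
      (T.rel x y ↔ T.rel (g x) (g y)) := by
    rintro x (rfl | hx) y (rfl | hy) h
    · exact absurd (hG.rfl' _ (by rw [gv]; exact hj)) h
    · rw [gS y hy, gv] at *; exact tw y hy h
    · rw [gS x hx, gv] at *; exact tw' x hx (fun k => h (hG.sym _ hj _ hx k))
    · rw [gS x hx, gS y hy]
  have sy : ∀ x ∈ S, ∀ y ∈ S, ¬ e x y → ¬ e y x := fun x hx y hy h k => h (hG.sym _ hy _ hx k)
  refine ⟨fun x y => e (g x) (g y), T.mkGood ?_ ?_ ?_ ?_ ?_ ?_ ?_⟩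
  · intro x hx; exact hG.rfl' _ (gm x hx)
  · intro x hx y hy; exact hG.sym _ (gm x hx) _ (gm y hy)
  · intro x hx y hy z hz; exact hG.trn _ (gm x hx) _ (gm y hy) _ (gm z hz)
  · intro x hx y hy z hz h1 h2 h3
    obtain ⟨m, h4⟩ := hG.mm (gm x hx) (gm y hy) (gm z hz) h1 h2
    rw [gr x hx z hz h2, m.1, ← gr y hy z hz h4] at h3
    exact h3
  · intro a ha b hb c hc d hd h1 h2 h3 h4 h5 h6 h
    refine hG.noD4 (gm a ha) (gm b hb) (gm c hc) (gm d hd) h1 h2 h3 h4 h5 (h.map ?_ ?_ ?_ ?_ ?_ ?_ ?_ ?_ ?_ ?_ ?_ ?_) <;>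
    apply gr <;> first | assumption | exact sy _ (gm _ ‹_›) _ (gm _ ‹_›) ‹_›
  · intro x hx y hy h1 h2
    have h1' := (gr x hx y hy h2).1 h1
    obtain ⟨z, hz, h3, h4⟩ := hG.ex _ (gm x hx) _ (gm y hy) h1' h2
    obtain ⟨e1, e2⟩ := hG.tri (gm x hx) (gm y hy) hz h1' h3 h4 h2
    have hz' := Set.mem_insert_of_mem v hz
    refine ⟨z, hz', (gr y hy z hz' ?_).2 ?_, (gr z hz' x hx ?_).2 ?_⟩ <;> rw [gS z hz] <;> assumption
  · obtain ⟨x, hx, y, hy, h⟩ := hG.nt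
    refine ⟨x, Set.mem_insert_of_mem v hx, y, Set.mem_insert_of_mem v hy, ?_⟩
    rw [gS x hx, gS y hy]; exact h

theorem D4.swap01 {T : Tournament V} {v x y z : V} (h : T.D4 v x y z) : T.D4 x v y z := by
  rcases h with h1 | h1 | h1 | h1 <;>
    obtain ⟨⟨t1, t2, t3⟩ | ⟨t1, t2, t3⟩, ⟨h1, h2, h3⟩ | ⟨h1, h2, h3⟩⟩ := h1 <;>
    simp [D4, Bad, Cyc, Hom3, t1, t2, t3, h1, h2, h3]

theorem D4.notwin {T : Tournament V} {a b c d : V} (h : T.D4 a b c d)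
    (k1 : T.rel a c ↔ T.rel b c) (k2 : T.rel a d ↔ T.rel b d)
    (k3 : T.rel c a ↔ T.rel c b) (k4 : T.rel d a ↔ T.rel d b) : False := by
  have := T.asymm
  rcases h with h1 | h1 | h1 | h1 <;>
    obtain ⟨⟨t1, t2, t3⟩ | ⟨t1, t2, t3⟩, ⟨h1, h2, h3⟩ | ⟨h1, h2, h3⟩⟩ := h1 <;> grind

/-- cyclic triangle `v p u`, `d` same on `p, u`, different on `v` -/
theorem D4.notri {T : Tournament V} {v p u d : V} (h : T.D4 v p u d) (h1 : T.rel v p)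
    (h2 : T.rel p u) (h3 : T.rel u v)
    (k1 : T.rel p d ↔ T.rel u d) (k3 : T.rel d p ↔ T.rel d u) (k2 : T.rel v d ↔ T.rel d p)
    (k4 : T.rel d v ↔ T.rel p d) : False := by
  have := T.asymm
  rcases h with h1 | h1 | h1 | h1 <;>
    obtain ⟨⟨t1, t2, t3⟩ | ⟨t1, t2, t3⟩, ⟨h1, h2, h3⟩ | ⟨h1, h2, h3⟩⟩ := h1 <;> grind

theorem three {a b c : Prop} (h1 : ¬ (a ↔ b)) (h2 : ¬ (a ↔ c)) (h3 : ¬ (b ↔ c)) : False := by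
  tauto

theorem antiExt (T : Tournament V) {S : Set V} {e} (hG : T.Good S e) {v j u0 p0 : V} (hv : v ∉ S)
    (hD : ∀ x ∈ S, ∀ y ∈ S, ∀ z ∈ S, ¬ e x y → ¬ e x z → ¬ e y z → ¬ T.D4 v x y z)
    (hj : j ∈ S) (hu : u0 ∈ S) (hp : p0 ∈ S) (eu : e j u0) (ep : e j p0)
    (hu' : T.rel u0 v) (hp' : T.rel v p0)
    (an : ∀ x ∈ S, ¬ e j x → (T.rel v x ↔ T.rel x j))
    (sep : ∀ u ∈ S, ∀ p ∈ S, e j u → e j p → T.rel u v → T.rel v p → T.rel p u) :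
    ∃ e', T.Good (insert v S) e' := by
  have nv : ∀ x ∈ S, x ≠ v := by rintro x hx rfl; exact hv hx
  have sy : ∀ x ∈ S, ∀ y ∈ S, ¬ e x y → ¬ e y x := fun x hx y hy h k => h (hG.sym _ hy _ hx k)
  have R : ∀ x ∈ S, (T.rel x v ↔ ¬ T.rel v x) := fun x hx => T.relnot (nv x hx).symm
  have an' : ∀ x ∈ S, ¬ e j x → (T.rel x v ↔ T.rel j x) := by
    intro x hx ex
    have n1 : v ≠ x := by rintro rfl; exact hv hx
    have n2 : x ≠ j := by rintro rfl; exact ex (hG.rfl' _ hx)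
    rw [T.relnot n1, T.relnot n2, an x hx ex]
  obtain ⟨e', he'⟩ : ∃ e' : V → V → Prop, e' = fun x y => (x = v ∧ y = v) ∨
    (x ≠ v ∧ y ≠ v ∧ e x y ∧ (T.rel v x ↔ T.rel v y)) := ⟨_, rfl⟩
  have E : ∀ x ∈ S, ∀ y ∈ S, (e' x y ↔ (e x y ∧ (T.rel v x ↔ T.rel v y))) := by
    intro x hx y hy
    simp [he', nv x hx, nv y hy]
  have Ev : ∀ x ∈ S, ¬ e' v x ∧ ¬ e' x v := by
    intro x hx; simp [he', nv x hx]
  have Evv : e' v v := by simp [he']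
  have F : ∀ b ∈ S, ∀ c ∈ S, e b c → ¬ e' b c → e j b ∧ e j c ∧
      ((T.rel b v ∧ T.rel v c ∧ T.rel c b) ∨ (T.rel c v ∧ T.rel v b ∧ T.rel b c)) := by
    intro b hb c hc ebc h
    have h' : ¬ (T.rel v b ↔ T.rel v c) := by
      rw [E b hb c hc] at h; exact fun k => h ⟨ebc, k⟩
    have eb : e j b := by
      by_contra eb
      have ec : ¬ e j c := fun k => eb (hG.trn _ hj _ hc _ hb k (hG.sym _ hb _ hc ebc))
      rw [an b hb eb, an c hc ec] at h'
      exact h' ((hG.mm hb hc hj ebc (sy _ hj _ hb eb)).1.1)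
    have ec := hG.trn _ hj _ hb _ hc eb ebc
    refine ⟨eb, ec, ?_⟩
    have r1 := R b hb
    have r2 := R c hc
    by_cases q : T.rel v b
    · have q2 : ¬ T.rel v c := fun k => h' (iff_of_true q k)
      exact Or.inr ⟨r2.2 q2, q, sep c hc b hb ec eb (r2.2 q2) q⟩
    · have q2 : T.rel v c := by
        by_contra k
        exact h' (iff_of_false q k)
      exact Or.inl ⟨r1.2 q, q2, sep b hb c hc eb ec (r1.2 q) q2⟩
  have F3 : ∀ b ∈ S, ∀ c ∈ S, ∀ d ∈ S, e b c → ¬ e' b c → ¬ e' b d → ¬ e' c d → ¬ e j d := by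
    intro b hb c hc d hd h1 h2 h3 h4 h5
    obtain ⟨g1, g2, _⟩ := F b hb c hc h1 h2
    have ebd := hG.trn _ hb _ hj _ hd (hG.sym _ hj _ hb g1) h5
    have ecd := hG.trn _ hc _ hj _ hd (hG.sym _ hj _ hc g2) h5
    rw [E _ hb _ hc] at h2
    rw [E _ hb _ hd] at h3
    rw [E _ hc _ hd] at h4
    exact three (fun k => h2 ⟨h1, k⟩) (fun k => h3 ⟨ebd, k⟩) (fun k => h4 ⟨ecd, k⟩)
  have A1 : ∀ b ∈ S, ∀ c ∈ S, ∀ d ∈ S, e b c → ¬ e' b c → ¬ e' b d → ¬ e' c d →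
      ¬ T.D4 v b c d := by
    intro b hb c hc d hd h1 h2 h3 h4
    have h5 := F3 b hb c hc d hd h1 h2 h3 h4
    obtain ⟨g1, g2, g⟩ := F b hb c hc h1 h2
    have mb := (hG.mm hj hb hd g1 h5).1
    have mc := (hG.mm hj hc hd g2 h5).1
    have k1 := an d hd h5
    have k2 := an' d hd h5
    rcases g with ⟨g3, g4, g5⟩ | ⟨g3, g4, g5⟩
    · exact fun h => h.rot.swap.notri g4 g5 g3 (mc.1.symm.trans mb.1) (mc.2.symm.trans mb.2)
        (k1.trans mc.2) (k2.trans mc.1)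
    · exact fun h => h.notri g4 g5 g3 (mb.1.symm.trans mc.1) (mb.2.symm.trans mc.2)
        (k1.trans mb.2) (k2.trans mb.1)
  have sy' : ∀ x ∈ S, ∀ y ∈ S, ¬ e' x y → ¬ e' y x := by
    intro x hx y hy h k
    rw [E _ hx _ hy] at h
    rw [E _ hy _ hx] at k
    exact h ⟨hG.sym _ hy _ hx k.1, k.2.symm⟩
  have A2 : ∀ b ∈ S, ∀ c ∈ S, ∀ d ∈ S, ¬ e' b c → ¬ e' b d → ¬ e' c d → ¬ T.D4 v b c d := by
    intro b hb c hc d hd h1 h2 h3 h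
    by_cases c1 : e b c
    · exact A1 b hb c hc d hd c1 h1 h2 h3 h
    by_cases c2 : e b d
    · exact A1 b hb d hd c hc c2 h2 h1 (sy' _ hc _ hd h3) h.swap
    by_cases c3 : e c d
    · exact A1 c hc d hd b hb c3 h3 (sy' _ hb _ hc h1) (sy' _ hb _ hd h2) h.rot
    exact hD b hb c hc d hd c1 c2 c3 h
  have B1 : ∀ a ∈ S, ∀ b ∈ S, ∀ c ∈ S, ∀ d ∈ S, e a b → ¬ e' a b → ¬ e' a c → ¬ e' a d → ¬ e' b c →
      ¬ e' b d → ¬ T.D4 a b c d := by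
    intro a ha b hb c hc d hd h0 h1 h2 h3 h4 h5 h
    obtain ⟨g1, g2, g⟩ := F a ha b hb h0 h1
    have k1 := F3 a ha b hb c hc h0 h1 h2 h4
    have k2 := F3 a ha b hb d hd h0 h1 h3 h5
    have m1 := (hG.mm hj ha hc g1 k1).1
    have m2 := (hG.mm hj hb hc g2 k1).1
    have m3 := (hG.mm hj ha hd g1 k2).1
    have m4 := (hG.mm hj hb hd g2 k2).1
    exact h.notwin (m1.1.symm.trans m2.1) (m3.1.symm.trans m4.1)
      (m1.2.symm.trans m2.2) (m3.2.symm.trans m4.2)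
  refine ⟨e', T.mkGood ?_ ?_ ?_ ?_ ?_ ?_ ?_⟩
  · rintro x (rfl | hx)
    · exact Evv
    · rw [E _ hx _ hx]; exact ⟨hG.rfl' _ hx, Iff.rfl⟩
  · rintro x (rfl | hx) y (rfl | hy) h
    · exact h
    · exact absurd h (Ev y hy).1
    · exact absurd h (Ev x hx).2
    · by_contra k; exact sy' _ hy _ hx k h
  · rintro x (rfl | hx) y (rfl | hy) z (rfl | hz) h1 h2 <;> first
    | assumption
    | exact absurd h1 (Ev _ ‹_›).1
    | exact absurd h1 (Ev _ ‹_›).2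
    | exact absurd h2 (Ev _ ‹_›).1
    | exact absurd h2 (Ev _ ‹_›).2
    | skip
    rw [E _ hx _ hy] at h1
    rw [E _ hy _ hz] at h2
    rw [E _ hx _ hz]
    exact ⟨hG.trn _ hx _ hy _ hz h1.1 h2.1, h1.2.trans h2.2⟩
  · rintro x (rfl | hx) y (rfl | hy) z hz h1 h2 h3 <;> first
    | assumption
    | exact absurd h1 (Ev _ ‹_›).1
    | exact absurd h1 (Ev _ ‹_›).2
    | skip
    have h1' := (E _ hx _ hy).1 h1
    rcases hz with rfl | hz
    · rw [R _ hx, h1'.2, ← R _ hy] at h3; exact h3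
    · by_cases exz : e x z
      · obtain ⟨g1, g2, ⟨g3, g4, g5⟩ | ⟨g3, g4, g5⟩⟩ := F _ hx _ hz exz h2
        · exact absurd g5 (T.asymm _ _ h3)
        · exact sep z hz y hy g2 (hG.trn _ hj _ hx _ hy g1 h1'.1) g3 (h1'.2.1 g4)
      · exact hG.mod _ hx _ hy _ hz h1'.1 exz h3
  · rintro a (rfl | ha) b (rfl | hb) c (rfl | hc) d (rfl | hd) h1 h2 h3 h4 h5 h6 h <;> first
    | exact absurd Evv ‹_›
    | exact A2 _ hb _ hc _ hd h4 h5 h6 h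
    | exact A2 _ ha _ hc _ hd h2 h3 h6 h.swap01
    | exact A2 _ ha _ hb _ hd h1 h3 h5 h.rot.swap01.swap
    | exact A2 _ ha _ hb _ hc h1 h2 h4 h.rot.rot.swap01
    | skip
    by_cases c1 : e a b
    · exact B1 _ ha _ hb _ hc _ hd c1 h1 h2 h3 h4 h5 h
    by_cases c2 : e a c
    · exact B1 _ ha _ hc _ hd _ hb c2 h2 h3 h1 h6 (sy' _ hb _ hc h4) h.rot
    by_cases c3 : e a d
    · exact B1 _ ha _ hd _ hb _ hc c3 h3 h1 h2 (sy' _ hb _ hd h5) (sy' _ hc _ hd h6) h.rot.rot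
    by_cases c4 : e b c
    · exact B1 _ hb _ hc _ ha _ hd c4 h4 (sy' _ ha _ hb h1) h5 (sy' _ ha _ hc h2) h6
        h.swap01.rot.swap
    by_cases c5 : e b d
    · exact B1 _ hb _ hd _ ha _ hc c5 h5 (sy' _ ha _ hb h1) h4 (sy' _ ha _ hd h3) (sy' _ hc _ hd h6)
        h.swap01.rot.rot
    exact hG.noD4 ha hb hc hd c1 c2 c3 c4 c5 h
  · obtain ⟨x1, hx1, z1, hz1, q1, q2, q3, q4, q5, q6⟩ := hG.ex3 hj
    rintro x (rfl | hx) y (rfl | hy) h1 h2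
    · exact absurd h1 (T.irr _)
    · by_cases ejy : e j y
      · exact ⟨x1, Or.inr hx1, (hG.mm hj hy hx1 ejy q4).1.1.1 q1, (an' _ hx1 q4).2 q1⟩
      · exact ⟨u0, Or.inr hu, (hG.mm hj hu hy eu ejy).1.2.1 ((an _ hy ejy).1 h1), hu'⟩
    · by_cases ejx : e j x
      · exact ⟨z1, Or.inr hz1, (an _ hz1 q5).2 q3, (hG.mm hj hx hz1 ejx q5).1.2.1 q3⟩
      · exact ⟨p0, Or.inr hp, hp', (hG.mm hj hp hx ep ejx).1.1.1 ((an' _ hx ejx).1 h1)⟩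
    · by_cases exy : e x y
      · obtain ⟨g1, g2, ⟨g3, g4, g5⟩ | ⟨g3, g4, g5⟩⟩ := F _ hx _ hy exy h2
        · exact absurd g5 (T.asymm _ _ h1)
        · exact ⟨v, Or.inl rfl, g3, g4⟩
      · obtain ⟨z, hz, h⟩ := hG.ex _ hx _ hy h1 exy
        exact ⟨z, Or.inr hz, h⟩
  · exact ⟨v, Or.inl rfl, j, Or.inr hj, (Ev j hj).1⟩

/-- One extension step. -/
theorem ext1 [Finite V] (T : Tournament V) {S : Set V} {e} (hG : T.Good S e)
    (hfat : ∀ F : List V, F.length ≤ 7 → ∃ α ∈ S, T.Fat {x | x ∈ F} α) {v : V} (hv : v ∉ S) :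
    ∃ e', T.Good (insert v S) e' := by
  have hD : ∀ x ∈ S, ∀ y ∈ S, ∀ z ∈ S, ¬ e x y → ¬ e x z → ¬ e y z → ¬ T.D4 v x y z :=
    fun x hx y hy z hz h1 h2 h3 => T.step1 hG hfat hv hx hy hz h1 h2 h3
  by_cases hm : ∀ x ∈ S, ∀ y ∈ S, e x y → (T.rel v x ↔ T.rel v y)
  · obtain ⟨j, hj, tw⟩ := T.unmixed hG hv hD hm
    exact T.twinExt hG hv hj tw
  · have : ∃ u ∈ S, ∃ p ∈ S, e u p ∧ T.rel u v ∧ T.rel v p := by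
      push Not at hm
      obtain ⟨x, hx, y, hy, exy, h⟩ := hm
      have r1 := T.relnot (x := v) (y := x) (by rintro rfl; exact hv hx)
      have r2 := T.relnot (x := v) (y := y) (by rintro rfl; exact hv hy)
      rcases h with h | h
      · exact ⟨y, hy, x, hx, hG.sym _ hx _ hy exy, r2.2 h.2, h.1⟩
      · exact ⟨x, hx, y, hy, exy, r1.2 h.1, h.2⟩
    obtain ⟨u, hu, p, hp, eup, h1, h2⟩ := this
    have euu := hG.rfl' _ hu
    rcases T.mixed hG hv hD hu hu hp euu eup h1 h2 with h | h
    · exact T.twinExt hG hv hu h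
    · exact T.antiExt hG hv hD hu hu hp euu eup h1 h2 h
        (fun u' hu' p' hp' eu' ep' k1 k2 => T.step1' hG hfat hv hu hu' hp' eu' ep' h k1 k2)

theorem initGood (T : Tournament V) {a b : V} {A : Set V} (hA : A.Nonempty)
    (h1 : ∀ x ∈ A, T.rel a x) (h2 : ∀ x ∈ A, T.rel x b) (h3 : T.rel b a) :
    ∃ e, T.Good ({a, b} ∪ A) e := by
  have n1 : ∀ x ∈ A, x ≠ a := by rintro x hx rfl; exact T.irr _ (h1 _ hx)
  have n2 : ∀ x ∈ A, x ≠ b := by rintro x hx rfl; exact T.irr _ (h2 _ hx)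
  have n3 : a ≠ b := by rintro rfl; exact T.irr _ h3
  obtain ⟨z, hz⟩ := hA
  have m : ∀ x ∈ ({a, b} ∪ A : Set V), x = a ∨ x = b ∨ x ∈ A := by
    intro x hx; simpa [or_assoc] using hx
  have ma : a ∈ ({a, b} ∪ A : Set V) := by simp
  have mb : b ∈ ({a, b} ∪ A : Set V) := by simp
  have mA : ∀ x ∈ A, x ∈ ({a, b} ∪ A : Set V) := fun x hx => by simp [hx]
  refine ⟨fun x y => (x = a ↔ y = a) ∧ (x = b ↔ y = b), T.mkGood ?_ ?_ ?_ ?_ ?_ ?_ ?_⟩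
  · intro x hx; exact ⟨Iff.rfl, Iff.rfl⟩
  · intro x hx y hy h; exact ⟨h.1.symm, h.2.symm⟩
  · intro x hx y hy z hz h k; exact ⟨h.1.trans k.1, h.2.trans k.2⟩
  · intro x hx y hy z hz e1 e2 hr
    have as := T.asymm x z hr
    rcases m x hx with rfl | rfl | hx <;> rcases m y hy with rfl | rfl | hy <;>
      rcases m z hz with rfl | rfl | hz <;> grind
  · intro x hx y hy z hz w hw e1 e2 e3 e4 e5 e6
    rcases m x hx with rfl | rfl | hx <;> rcases m y hy with rfl | rfl | hy <;>
      rcases m z hz with rfl | rfl | hz <;> rcases m w hw with rfl | rfl | hw <;> grind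
  · intro x hx y hy hr he
    have as := T.asymm x y hr
    rcases m x hx with rfl | rfl | hx' <;> rcases m y hy with rfl | rfl | hy'
    · grind
    · exact absurd h3 as
    · exact ⟨b, mb, h2 _ hy', h3⟩
    · exact ⟨z, mA z hz, h1 _ hz, h2 _ hz⟩
    · grind
    · exact absurd (h2 _ hy') as
    · exact absurd (h1 _ hx') as
    · exact ⟨a, ma, h3, h1 _ hx'⟩
    · grind
  · exact ⟨a, ma, b, mb, by grind⟩

theorem hasSub_mk (T : Tournament V) {n : ℕ} (r : Fin n → Fin n → Prop) (f : Fin n → V)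
    (h0 : ∀ i, ¬ r i i)
    (h : ∀ i j, i < j → (r i j ∧ T.rel (f i) (f j) ∧ ¬ r j i) ∨
      (r j i ∧ T.rel (f j) (f i) ∧ ¬ r i j)) : T.HasSub r := by
  refine ⟨f, ?_, ?_⟩
  · intro i j hij
    by_contra hne
    have ir := T.irr
    rcases lt_or_gt_of_ne hne with hl | hl
    · have := h i j hl
      rw [hij] at this
      have := T.irr (f j)
      tauto
    · have := h j i hl
      rw [hij] at this
      have := T.irr (f j)
      tauto
  · intro i j
    rcases lt_trichotomy i j with hl | hl | hl
    · have := h i j hl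
      have := T.asymm (f i) (f j)
      tauto
    · subst hl
      have := h0 i
      have := T.irr (f i)
      tauto
    · have := h j i hl
      have := T.asymm (f i) (f j)
      tauto

theorem mkK (T : Tournament V) {n : ℕ} (hn : 3 ≤ n) {w p q : V} {g : ℕ → V}
    (hg : ∀ i j, i < j → j < n - 3 → T.rel (g i) (g j))
    (h1 : ∀ i, i < n - 3 → T.rel p (g i)) (h2 : ∀ i, i < n - 3 → T.rel (g i) q) (h3 : T.rel q p)
    (w1 : T.rel w p) (w2 : T.rel w q) (w3 : ∀ i, i < n - 3 → T.rel w (g i)) :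
    T.HasSub (KKrel n) := by
  refine T.hasSub_mk _ (fun i => if i.val = 0 then w else if i.val = n - 1 then q else
    if i.val = 1 then p else g (i.val - 2)) ?_ ?_
  · intro i; simp only [KKrel]; omega
  · intro i j hij
    have hij' : i.val < j.val := hij
    have hj := j.2
    simp only [KKrel]
    by_cases hs : i.val = 1 ∧ j.val = n - 1
    · right
      refine ⟨by omega, ?_, by omega⟩
      rw [if_neg (by omega), if_pos (by omega), if_neg (by omega), if_neg (by omega), if_pos (by omega)]
      exact h3
    · left
      refine ⟨by omega, ?_, by omega⟩
      rw [if_neg (show ¬ j.val = 0 by omega)]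
      split_ifs <;> first
        | assumption
        | omega
        | (apply w3; omega)
        | (apply h1; omega)
        | (apply h2; omega)
        | (apply hg <;> omega)

theorem mkKs (T : Tournament V) {n : ℕ} (hn : 3 ≤ n) {w p q : V} {g : ℕ → V}
    (hg : ∀ i j, i < j → j < n - 3 → T.rel (g i) (g j))
    (h1 : ∀ i, i < n - 3 → T.rel p (g i)) (h2 : ∀ i, i < n - 3 → T.rel (g i) q) (h3 : T.rel q p)
    (w1 : T.rel p w) (w2 : T.rel q w) (w3 : ∀ i, i < n - 3 → T.rel (g i) w) :
    T.HasSub (KKsrel n) := by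
  refine T.hasSub_mk _ (fun i => if i.val = n - 1 then w else if i.val = n - 2 then q else
    if i.val = 0 then p else g (i.val - 1)) ?_ ?_
  · intro i; simp only [KKsrel]; omega
  · intro i j hij
    have hij' : i.val < j.val := hij
    have hj := j.2
    simp only [KKsrel]
    by_cases hs : i.val = 0 ∧ j.val = n - 2
    · right
      refine ⟨by omega, ?_, by omega⟩
      rw [if_neg (by omega), if_pos (by omega), if_neg (by omega), if_neg (by omega), if_pos (by omega)]
      exact h3
    · left
      refine ⟨by omega, ?_, by omega⟩
      rw [if_neg (show ¬ i.val = n - 1 by omega)]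
      split_ifs <;> first
        | assumption
        | omega
        | (apply w3; omega)
        | (apply h1; omega)
        | (apply h2; omega)
        | (apply hg <;> omega)

theorem pigeon (T : Tournament V) (c : ℕ → V) (m : ℕ) : ∀ (F : List V) (I : Finset ℕ),
    (∀ i ∈ I, ∀ j ∈ I, i < j → T.rel (c i) (c j)) → 2 ^ F.length * (m + 1) ≤ I.card + 1 →
    ∃ I' ⊆ I, m ≤ I'.card ∧
      ∀ f ∈ F, (∀ i ∈ I', T.rel f (c i)) ∨ (∀ i ∈ I', T.rel (c i) f) := by
  classical
  intro F
  induction F with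
  | nil => intro I _ h; exact ⟨I, subset_rfl, by simpa using h, by simp⟩
  | cons f F ih =>
    intro I hI h
    have hc : I.card ≤ (I.filter (fun i => T.rel f (c i))).card +
        (I.filter (fun i => T.rel (c i) f)).card + 1 := by
      have h3 : (I.filter (fun i => c i = f)).card ≤ 1 := by
        rw [Finset.card_le_one]
        intro i hi j hj
        simp only [Finset.mem_filter] at hi hj
        by_contra hne
        rcases lt_or_gt_of_ne hne with hl | hl
        · have := hI i hi.1 j hj.1 hl
          rw [hi.2, hj.2] at this
          exact T.irr _ this
        · have := hI j hj.1 i hi.1 hl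
          rw [hi.2, hj.2] at this
          exact T.irr _ this
      have hs : I ⊆ ((I.filter (fun i => T.rel f (c i))) ∪ (I.filter (fun i => T.rel (c i) f))) ∪
          (I.filter (fun i => c i = f)) := by
        intro i hi
        simp only [Finset.mem_union, Finset.mem_filter, hi, true_and]
        by_cases hf : c i = f
        · exact Or.inr hf
        · exact Or.inl (T.total _ _ (Ne.symm hf))
      have k1 := Finset.card_le_card hs
      have k2 := Finset.card_union_le ((I.filter (fun i => T.rel f (c i))) ∪ (I.filter (fun i => T.rel (c i) f)))
          (I.filter (fun i => c i = f))
      have k3 := Finset.card_union_le (I.filter (fun i => T.rel f (c i))) (I.filter (fun i => T.rel (c i) f))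
      omega
    rw [List.length_cons, pow_succ] at h
    have : 2 ^ F.length * (m + 1) ≤ (I.filter (fun i => T.rel f (c i))).card + 1 ∨
        2 ^ F.length * (m + 1) ≤ (I.filter (fun i => T.rel (c i) f)).card + 1 := by
      have : 2 ^ F.length * 2 * (m + 1) = 2 * (2 ^ F.length * (m + 1)) := by ring
      omega
    rcases this with h' | h'
    · obtain ⟨I', h1, h2, h3⟩ := ih _ (fun i hi j hj => hI i (Finset.filter_subset _ _ hi) j (Finset.filter_subset _ _ hj)) h'
      refine ⟨I', h1.trans (Finset.filter_subset _ _), h2, ?_⟩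
      intro x hx
      rcases List.mem_cons.1 hx with rfl | hx
      · exact Or.inl (fun i hi => (Finset.mem_filter.1 (h1 hi)).2)
      · exact h3 x hx
    · obtain ⟨I', h1, h2, h3⟩ := ih _ (fun i hi j hj => hI i (Finset.filter_subset _ _ hi) j (Finset.filter_subset _ _ hj)) h'
      refine ⟨I', h1.trans (Finset.filter_subset _ _), h2, ?_⟩
      intro x hx
      rcases List.mem_cons.1 hx with rfl | hx
      · exact Or.inr (fun i hi => (Finset.mem_filter.1 (h1 hi)).2)
      · exact h3 x hx

theorem enum (I : Finset ℕ) (m : ℕ) (h : m ≤ I.card) : ∃ o : ℕ → ℕ,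
    (∀ i j, i < j → j < m → o i < o j) ∧ ∀ i, i < m → o i ∈ I := by
  refine ⟨fun i => if hi : i < I.card then I.orderEmbOfFin rfl ⟨i, hi⟩ else 0, ?_, ?_⟩
  · intro i j hij hj
    simp only
    rw [dif_pos (by omega), dif_pos (by omega)]
    simpa using hij
  · intro i hi
    simp only
    rw [dif_pos (by omega)]
    exact Finset.orderEmbOfFin_mem _ _ _

theorem fat (T : Tournament V) {n : ℕ} (hn : 3 ≤ n) (hK : ¬ T.HasSub (KKrel n))
    (hKs : ¬ T.HasSub (KKsrel n)) (c : ℕ → V) (N : ℕ) (hN : 2 ^ 7 * (n + 1) ≤ N + 1)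
    (hc : ∀ i j, i < j → j < N → T.rel (c i) (c j)) (F : List V) (hF : F.length ≤ 7) :
    ∃ i, i < N ∧ T.Fat {x | x ∈ F} (c i) := by
  have hp : 2 ^ F.length * (n + 1) ≤ 2 ^ 7 * (n + 1) :=
    Nat.mul_le_mul_right _ (Nat.pow_le_pow_right (by norm_num) hF)
  obtain ⟨I, h1, h2, h3⟩ := T.pigeon c n F (Finset.range N)
    (fun i _ j hj hij => hc i j hij (Finset.mem_range.1 hj)) (by rw [Finset.card_range]; omega)
  obtain ⟨o, o1, o2⟩ := enum I n h2
  have hi0 : o 0 ∈ I := o2 0 (by omega)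
  have key : ∀ p ∈ F, ∀ q ∈ F, ∀ w ∈ F, T.rel p (c (o 0)) → T.rel (c (o 0)) q → T.rel q p →
      ¬ T.Hom3 w (c (o 0)) p q := by
    intro p hp q hq w hw t1 t2 t3 hom
    have hg : ∀ i j, i < j → j < n - 3 → T.rel (c (o i)) (c (o j)) := by
      intro i j hij hj
      exact hc _ _ (o1 i j hij (by omega)) (Finset.mem_range.1 (h1 (o2 j (by omega))))
    have g1 : ∀ i, i < n - 3 → T.rel p (c (o i)) := by
      intro i hi
      rcases h3 p hp with h | h
      · exact h _ (o2 i (by omega))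
      · exact absurd t1 (T.asymm _ _ (h _ hi0))
    have g2 : ∀ i, i < n - 3 → T.rel (c (o i)) q := by
      intro i hi
      rcases h3 q hq with h | h
      · exact absurd t2 (T.asymm _ _ (h _ hi0))
      · exact h _ (o2 i (by omega))
    rcases hom with ⟨k1, k2, k3⟩ | ⟨k1, k2, k3⟩
    · refine hK (T.mkK hn (g := fun i => c (o i)) hg g1 g2 t3 k2 k3 ?_)
      intro i hi
      rcases h3 w hw with h | h
      · exact h _ (o2 i (by omega))
      · exact absurd k1 (T.asymm _ _ (h _ hi0))
    · refine hKs (T.mkKs hn (g := fun i => c (o i)) hg g1 g2 t3 k2 k3 ?_)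
      intro i hi
      rcases h3 w hw with h | h
      · exact absurd k1 (T.asymm _ _ (h _ hi0))
      · exact h _ (o2 i (by omega))
  refine ⟨o 0, Finset.mem_range.1 (h1 hi0), ?_, ?_⟩
  · intro h
    rcases h3 _ h with h | h <;> exact T.irr _ (h _ hi0)
  · rintro x hx y hy w hw ⟨⟨t1, t2, t3⟩ | ⟨t1, t2, t3⟩, hom⟩
    · refine key y hy x hx w hw t3 t1 t2 ?_
      rcases hom with ⟨a, b, c⟩ | ⟨a, b, c⟩
      · exact Or.inl ⟨a, c, b⟩
      · exact Or.inr ⟨a, c, b⟩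
    · exact key x hx y hy w hw t3 t1 t2 hom

theorem exGood [Finite V] (T : Tournament V) {n k : ℕ} (hn : 3 ≤ n) (hK : ¬ T.HasSub (KKrel n))
    (hKs : ¬ T.HasSub (KKsrel n)) (hk : k = 2 ^ 7 * (n + 1) + 2) (hJ : T.HasSub (JJrel k)) :
    ∃ e, T.Good Set.univ e := by
  obtain ⟨f, -, hf⟩ := hJ
  have k0 : 0 < k := by omega
  let c : ℕ → V := fun i => if h : i + 1 < k then f ⟨i + 1, h⟩ else f ⟨0, k0⟩
  have cc : ∀ i, (h : i + 1 < k) → c i = f ⟨i + 1, h⟩ := fun i h => dif_pos h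
  have hc : ∀ i j, i < j → j < k - 2 → T.rel (c i) (c j) := by
    intro i j hij hj
    rw [cc i (by omega), cc j (by omega), ← hf]
    simp only [JJrel]; omega
  have hfat := T.fat hn hK hKs c (k - 2) (by omega) hc
  obtain ⟨a, ha⟩ : ∃ a, a = f ⟨0, k0⟩ := ⟨_, rfl⟩
  obtain ⟨b, hb⟩ : ∃ b, b = f ⟨k - 1, by omega⟩ := ⟨_, rfl⟩
  obtain ⟨A, hA⟩ : ∃ A : Set V, A = {x | ∃ i, i < k - 2 ∧ x = c i} := ⟨_, rfl⟩
  have h0 : ∃ e, T.Good ({a, b} ∪ A) e := by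
    apply T.initGood
    · rw [hA]; exact ⟨c 0, 0, by omega, rfl⟩
    · rw [hA]; rintro x ⟨i, hi, rfl⟩
      rw [cc i (by omega), ha, ← hf]
      simp only [JJrel]; omega
    · rw [hA]; rintro x ⟨i, hi, rfl⟩
      rw [cc i (by omega), hb, ← hf]
      simp only [JJrel]; omega
    · rw [ha, hb, ← hf]; exact Or.inr ⟨rfl, rfl⟩
  have ind : ∀ U : Set V, U.Finite → ∃ e, T.Good (({a, b} ∪ A) ∪ U) e := by
    intro U hU
    induction U, hU using Set.Finite.induction_on with
    | empty => simpa using h0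
    | @insert v U _ _ ih =>
      obtain ⟨e, he⟩ := ih
      rw [Set.union_insert]
      by_cases hv : v ∈ (({a, b} ∪ A) ∪ U)
      · rw [Set.insert_eq_of_mem hv]; exact ⟨e, he⟩
      · refine T.ext1 he ?_ hv
        intro F hF
        obtain ⟨i, hi, h⟩ := hfat F hF
        exact ⟨c i, Or.inl (Or.inr (by rw [hA]; exact ⟨i, hi, rfl⟩)), h⟩
  have := ind Set.univ Set.finite_univ
  rwa [Set.union_univ] at this

/-- A locally transitive tournament in which every edge is in a cyclic triangle is some `T_r`. -/
theorem circ {Q : Type} [Finite Q] (T : Tournament Q) (x1 x2 : Q) (hne : x1 ≠ x2)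
    (LT : ∀ x p q s, T.Cyc p q s → ¬ T.Hom3 x p q s)
    (EX : ∀ x y, T.rel x y → ∃ z, T.rel y z ∧ T.rel z x) :
    ∃ r : ℕ, Odd r ∧ 3 ≤ r ∧ ∃ φ : ℕ → Q, (∀ x, ∃ i, i < r ∧ φ i = x) ∧
      (∀ i j, i < r → j < r → φ i = φ j → i = j) ∧
      ∀ i j : Fin r, (T.rel (φ i) (φ j) ↔ TTrel r i j) := by
  have out : ∀ x, ∃ y, T.rel x y := by
    intro x
    obtain ⟨y, hy⟩ : ∃ y, x ≠ y := by
      by_cases h : x = x1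
      · exact ⟨x2, by rw [h]; exact hne⟩
      · exact ⟨x1, h⟩
    rcases T.total _ _ hy with h | h
    · exact ⟨y, h⟩
    · obtain ⟨z, hz, _⟩ := EX _ _ h
      exact ⟨z, hz⟩
  have trans : ∀ x a b c, T.rel x a → T.rel x b → T.rel x c → T.rel a b → T.rel b c → T.rel a c := by
    intro x a b c h1 h2 h3 h4 h5
    have n : c ≠ a := by rintro rfl; exact T.asymm _ _ h4 h5
    rw [T.relnot n]
    intro h6
    exact LT x a b c ⟨h4, h5, h6⟩ (Or.inl ⟨h1, h2, h3⟩)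
  have src : ∀ x, ∃ y, T.rel x y ∧ ∀ z, T.rel x z → z ≠ y → T.rel y z := by
    intro x
    obtain ⟨m, hm, h⟩ := exmin {y | T.rel x y} T.rel (out x) (fun a _ => T.irr a)
      (fun a ha b hb c hc => trans x a b c ha hb hc)
    exact ⟨m, hm, fun z hz hn => (T.total _ _ hn).resolve_left (h z hz)⟩
  choose s s1 s2 using src
  have it : ∀ t x, s^[t + 1] x = s (s^[t] x) := fun t x => Function.iterate_succ_apply' s t x
  have exD : ∀ x, ∃ D, 1 ≤ D ∧ ¬ T.rel x (s^[D] x) := by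
    intro x
    by_contra hcon
    push Not at hcon
    obtain ⟨m, ⟨i, hi, rfl⟩, h⟩ := exmin {y | ∃ i, 1 ≤ i ∧ y = s^[i] x} (fun a b => T.rel b a)
      ⟨_, 1, le_rfl, rfl⟩ (fun a _ => T.irr a) (by
        rintro _ ⟨i, hi, rfl⟩ _ ⟨j, hj, rfl⟩ _ ⟨l, hl, rfl⟩ h1 h2
        exact trans x _ _ _ (hcon l hl) (hcon j hj) (hcon i hi) h2 h1)
    exact h (s^[i + 1] x) ⟨i + 1, by omega, rfl⟩ (by rw [it]; exact s1 _)
  have exD2 : ∀ x, ∃ D, 2 ≤ D ∧ (∀ j, 1 ≤ j → j < D → T.rel x (s^[j] x)) ∧ ¬ T.rel x (s^[D] x) := by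
    classical
    intro x
    obtain ⟨h1, h2⟩ := Nat.find_spec (exD x)
    refine ⟨Nat.find (exD x), ?_, ?_, h2⟩
    · by_contra h
      have h3 : Nat.find (exD x) = 1 := by omega
      rw [h3] at h2
      exact h2 (s1 x)
    · intro j hj hj'
      have := Nat.find_min (exD x) hj'
      by_contra hh
      exact this ⟨hj, hh⟩
  choose D D1 D2 D3 using exD2
  -- the last step returns
  have pen : ∀ x, T.rel (s^[D x - 1] x) (s^[D x] x) ∧ T.rel x (s^[D x - 1] x) := by
    intro x
    have h := D1 x
    constructor
    · obtain ⟨d, hd⟩ : ∃ d, D x = d + 1 := ⟨D x - 1, by omega⟩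
      rw [hd, it]; exact s1 _
    · exact D2 x _ (by omega) (by omega)
  have D4' : ∀ x, T.rel (s^[D x] x) x := by
    intro x
    have n : x ≠ s^[D x] x := by
      intro h
      have := pen x
      rw [← h] at this
      exact T.asymm _ _ this.1 this.2
    exact (T.relnot n).2 (D3 x)
  have Dout : ∀ x z, T.rel x z → ∃ j, 1 ≤ j ∧ j < D x ∧ z = s^[j] x := by
    intro x z hz
    by_contra hcon
    push Not at hcon
    have h1 : ∀ j, 1 ≤ j → j < D x → T.rel (s^[j] x) z := by
      intro j hj
      induction j, hj using Nat.le_induction with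
      | base => intro h; exact s2 x z hz (hcon 1 le_rfl h)
      | succ j hj ih =>
        intro h
        have := ih (by omega)
        rw [it]
        refine s2 _ z this ?_
        rw [← it]
        exact hcon _ (by omega) h
    have h2 := D1 x
    obtain ⟨d, hd⟩ : ∃ d, D x = d + 1 := ⟨D x - 1, by omega⟩
    have h3 := h1 d (by omega) (by omega)
    have p := pen x
    have q := D4' x
    have hzx : z ≠ s^[D x] x := by
      rintro rfl; exact T.asymm _ _ hz q
    have h4 : T.rel (s^[D x] x) z := by
      rw [hd, it] at hzx ⊢
      exact s2 _ z h3 hzx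
    have : D x - 1 = d := by omega
    rw [this] at p
    exact LT z x (s^[d] x) (s^[D x] x) ⟨p.2, p.1, q⟩ (Or.inr ⟨hz, h3, h4⟩)
  have chain : ∀ x a b, 1 ≤ a → a < b → b < D x → T.rel (s^[a] x) (s^[b] x) := by
    intro x a b ha hab
    induction b, hab using Nat.le_induction with
    | base => intro _; rw [Nat.succ_eq_add_one, it]; exact s1 _
    | succ b hb ih =>
      intro h
      exact trans x _ _ _ (D2 x _ ha (by omega)) (D2 x b (by omega) (by omega))
        (D2 x (b + 1) (by omega) h) (ih (by omega)) (by rw [it]; exact s1 _)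
  have last : ∀ x, T.rel (s x) (s^[D x] x) := by
    intro x
    have h2 := D1 x
    by_cases hD : D x = 2
    · rw [hD, it]; exact s1 _
    obtain ⟨l, l1, l2⟩ := EX _ _ (s1 x)
    have p := pen x
    have q := D4' x
    have c1 : T.rel (s x) (s^[D x - 1] x) := chain x 1 (D x - 1) le_rfl (by omega) (by omega)
    have h3 : T.rel (s^[D x - 1] x) l := by
      have n : l ≠ s^[D x - 1] x := by
        intro h
        rw [h] at l2
        exact T.asymm _ _ l2 p.2
      rw [T.relnot n]
      intro h
      exact LT (s^[D x - 1] x) x (s x) l ⟨s1 x, l1, l2⟩ (Or.inr ⟨p.2, c1, h⟩)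
    by_contra hcon
    have n2 : s x ≠ s^[D x] x := by
      intro h
      rw [← h] at q
      exact T.asymm _ _ (s1 x) q
    have h4 := (T.relnot n2).2 hcon
    have n3 : l ≠ s^[D x] x := by
      rintro rfl; exact hcon l1
    have h5 : T.rel (s^[D x] x) l := by
      obtain ⟨d, hd⟩ : ∃ d, D x = d + 1 := ⟨D x - 1, by omega⟩
      have : D x - 1 = d := by omega
      rw [this] at h3
      rw [hd, it] at n3 ⊢
      exact s2 _ _ h3 n3
    exact LT (s^[D x] x) x (s x) l ⟨s1 x, l1, l2⟩ (Or.inl ⟨q, h4, h5⟩)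
  have mono : ∀ x, D x ≤ D (s x) := by
    intro x
    by_contra h
    apply D3 (s x)
    rw [← Function.iterate_succ_apply]
    by_cases h' : D (s x) + 1 = D x
    · rw [Nat.succ_eq_add_one, h']; exact last x
    · exact chain x 1 _ le_rfl (by have := D1 (s x); omega) (by omega)
  haveI : Nonempty Q := ⟨x1⟩
  obtain ⟨x0, hx0⟩ := Finite.exists_max D
  have Dc : ∀ t, D (s^[t] x0) = D x0 := by
    intro t
    induction t with
    | zero => rfl
    | succ t ih =>
      rw [it]
      have := mono (s^[t] x0)
      have := hx0 (s (s^[t] x0))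
      omega
  obtain ⟨d, hd⟩ : ∃ d, D x0 = d + 1 := ⟨D x0 - 1, by have := D1 x0; omega⟩
  have hd1 : 1 ≤ d := by have := D1 x0; omega
  obtain ⟨y, hy⟩ : ∃ y : ℕ → Q, y = fun t => s^[t] x0 := ⟨_, rfl⟩
  have ya : ∀ t j, s^[j] (s^[t] x0) = y (t + j) := by
    intro t j; rw [hy, ← Function.iterate_add_apply, add_comm]
  have y1 : ∀ t j, 1 ≤ j → j ≤ d → T.rel (y t) (y (t + j)) := by
    intro t j h1 h2
    rw [← ya t j, hy]
    exact D2 _ j h1 (by rw [Dc]; omega)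
  have y2 : ∀ t, T.rel (y (t + d + 1)) (y t) := by
    intro t
    have := D4' (s^[t] x0)
    rw [Dc, ya, hd] at this
    rw [hy] at this ⊢
    exact this
  have y3 : ∀ t z, T.rel (y t) z → ∃ j, 1 ≤ j ∧ j ≤ d ∧ z = y (t + j) := by
    intro t z hz
    rw [hy] at hz
    obtain ⟨j, h1, h2, h3⟩ := Dout _ _ hz
    rw [Dc] at h2
    exact ⟨j, h1, by omega, by rw [h3, ya]⟩
  obtain ⟨z, z1, z2⟩ := EX _ _ (y1 0 1 le_rfl hd1)
  obtain ⟨j, j1, j2, rfl⟩ := y3 _ _ z1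
  have surj : ∀ x, ∃ t, y t = x := by
    intro x
    by_contra hcon
    push Not at hcon
    have h : ∀ t, T.rel x (y t) := by
      intro t
      rw [T.relnot (hcon t)]
      intro h
      obtain ⟨j, _, _, h⟩ := y3 _ _ h
      exact hcon _ h.symm
    exact LT x _ _ _ ⟨y1 0 1 le_rfl hd1, z1, z2⟩ (Or.inl ⟨h _, h _, h _⟩)
  obtain ⟨i, i1, i2, hi⟩ := y3 _ _ z2
  have per : x0 ∈ Function.periodicPts s := by
    refine ⟨0 + 1 + j + i, by omega, ?_⟩
    show s^[0 + 1 + j + i] x0 = x0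
    rw [hy] at hi
    exact hi.symm
  obtain ⟨r, hr⟩ : ∃ r, r = Function.minimalPeriod s x0 := ⟨_, rfl⟩
  have rpos : 0 < r := by rw [hr]; exact Function.minimalPeriod_pos_of_mem_periodicPts per
  have ymod : ∀ t, y (t % r) = y t := by
    intro t; rw [hy, hr]; exact Function.iterate_mod_minimalPeriod_eq
  have yinj : ∀ i j, i < r → j < r → y i = y j → i = j := by
    intro i j hi hj h
    rw [hy] at h
    rw [hr] at hi hj
    exact (Function.iterate_eq_iterate_iff_of_lt_minimalPeriod hi hj).1 h
  have yinj' : ∀ i j, y i = y j → i % r = j % r := by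
    intro i j h
    rw [← ymod i, ← ymod j] at h
    exact yinj _ _ (Nat.mod_lt _ rpos) (Nat.mod_lt _ rpos) h
  have yadd : ∀ t, y (t + r) = y t := by
    intro t; rw [← ymod (t + r), Nat.add_mod_right, ymod]
  have dr : d < r := by
    by_contra h
    have := y1 0 r (by omega) (by omega)
    rw [yadd] at this
    exact T.irr _ this
  have dr2 : d + 1 < r := by
    by_contra h
    have h : r = d + 1 := by omega
    have := y2 0
    rw [add_assoc, ← h, yadd] at this
    exact T.irr _ this
  have main : ∀ t m, 1 ≤ m → m < r → (T.rel (y t) (y (t + m)) ↔ m ≤ d) := by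
    intro t m h1 h2
    refine ⟨fun h => ?_, fun h => y1 t m h1 h⟩
    obtain ⟨j, h3, h4, h5⟩ := y3 _ _ h
    have h6 : (t + m) ≡ (t + j) [MOD r] := yinj' _ _ h5
    have h7 : m ≡ j [MOD r] := Nat.ModEq.add_left_cancel' t h6
    have h8 : m % r = j % r := h7
    rw [Nat.mod_eq_of_lt h2, Nat.mod_eq_of_lt (by omega)] at h8
    omega
  have r1 : r - (d + 1) ≤ d := by
    have := y2 0
    rw [← main (0 + d + 1) (r - (d + 1)) (by omega) (by omega)]
    have e : 0 + d + 1 + (r - (d + 1)) = 0 + r := by omega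
    rw [e, yadd]
    exact this
  have r2 : ¬ (r - d ≤ d) := by
    rw [← main (0 + d) (r - d) (by omega) (by omega)]
    have e : 0 + d + (r - d) = 0 + r := by omega
    rw [e, yadd]
    exact T.asymm _ _ (y1 0 d hd1 le_rfl)
  have r3 : r = 2 * d + 1 := by omega
  refine ⟨r, ⟨d, r3⟩, by omega, y, ?_, yinj, ?_⟩
  · intro x
    obtain ⟨t, ht⟩ := surj x
    exact ⟨t % r, Nat.mod_lt _ rpos, by rw [ymod, ht]⟩
  · intro i j
    have hi := i.2
    have hj := j.2
    have hrd : r / 2 = d := by omega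
    unfold TTrel
    rw [hrd]
    have hm : (j.val + r - i.val) % r < r := Nat.mod_lt _ rpos
    have hy : y (i.val + (j.val + r - i.val) % r) = y j.val := by
      rw [← ymod, Nat.add_mod_mod]
      have e : i.val + (j.val + r - i.val) = j.val + r := by omega
      rw [e, ymod, yadd]
    generalize (j.val + r - i.val) % r = m at hm hy
    rw [← hy]
    by_cases h0 : m = 0
    · subst h0
      simp only [add_zero]
      have := T.irr (y i.val)
      constructor
      · intro h; exact absurd h this
      · intro h; omega
    · rw [main _ _ (by omega) hm]; omega

theorem final [Finite V] (T : Tournament V) {e : V → V → Prop} (hG : T.Good Set.univ e) :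
    ∃ r : ℕ, Odd r ∧ 3 ≤ r ∧ ∃ P : Fin r → Set V,
        (∀ i, (P i).Nonempty) ∧ (⋃ i, P i) = Set.univ ∧
        (∀ i j, i ≠ j → Disjoint (P i) (P j)) ∧
        (∀ i j, i ≠ j → ∀ u ∈ P i, ∀ v ∈ P j, (T.rel u v ↔ TTrel r i j)) := by
  have u : ∀ x : V, x ∈ (Set.univ : Set V) := fun x => trivial
  let st : Setoid V := ⟨e, fun x => hG.rfl' x (u x), fun {x y} => hG.sym x (u x) y (u y),
    fun {x y z} => hG.trn x (u x) y (u y) z (u z)⟩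
  let Q := Quotient st
  have oe : ∀ q q' : Q, q ≠ q' ↔ ¬ e q.out q'.out := by
    intro q q'
    constructor
    · intro h k
      exact h (Quotient.out_equiv_out.1 k)
    · rintro h rfl
      exact h (hG.rfl' _ (u _))
  let TQ : Tournament Q :=
    { rel := fun q q' => q ≠ q' ∧ T.rel q.out q'.out
      asymm := fun q q' h k => T.asymm _ _ h.2 k.2
      total := by
        intro q q' h
        have : q.out ≠ q'.out := by
          intro k
          have := (oe _ _).1 h
          rw [k] at this
          exact this (hG.rfl' _ (u _))
        rcases T.total _ _ this with k | k
        · exact Or.inl ⟨h, k⟩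
        · exact Or.inr ⟨h.symm, k⟩ }
  have rq : ∀ x y : V, ¬ e x y → (T.rel x y ↔ TQ.rel (Quotient.mk st x) (Quotient.mk st y)) := by
    intro x y h
    have ex : e x (Quotient.mk st x).out := st.symm (Quotient.mk_out x)
    have ey : e y (Quotient.mk st y).out := st.symm (Quotient.mk_out y)
    obtain ⟨m1, h1⟩ := hG.mm (u x) (u _) (u y) ex h
    obtain ⟨m2, h2⟩ := hG.mm (u y) (u _) (u (Quotient.mk st x).out) ey
      (fun k => h1 (hG.sym _ (u _) _ (u _) k))
    rw [m1.1, m2.2]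
    refine ⟨fun k => ⟨?_, k⟩, fun k => k.2⟩
    intro k'
    exact h (Quotient.exact k')
  have ne : ∀ x y : V, Quotient.mk st x ≠ Quotient.mk st y → ¬ e x y := by
    intro x y h k
    exact h (Quotient.sound k)
  have nei : ∀ x y : Q, TQ.rel x y → x ≠ y := fun x y h => h.1
  have key := TQ.circ
  obtain ⟨x1, -, x2, -, h12⟩ := hG.nt
  obtain ⟨r, r1, r2, φ, f1, f2, f3⟩ := TQ.circ (Quotient.mk st x1) (Quotient.mk st x2)
    (fun k => h12 (Quotient.exact k)) (by
      rintro x p q s ⟨t1, t2, t3⟩ h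
      refine (oe _ _).1 t1.1 ?_
      rcases h with ⟨h1, h2, h3⟩ | ⟨h1, h2, h3⟩
      · exact hG.lt x.out (u _) _ (u _) _ (u _) _ (u _) t1.2 t2.2 t3.2 h1.2 h2.2 h3.2
      · exact hG.lt' x.out (u _) _ (u _) _ (u _) _ (u _) t1.2 t2.2 t3.2 h1.2 h2.2 h3.2) (by
      intro x y h
      have e1 := (oe _ _).1 h.1
      obtain ⟨z, hz, z1, z2⟩ := hG.ex _ (u _) _ (u _) h.2 e1
      obtain ⟨k1, k2⟩ := hG.tri (u _) (u _) hz h.2 z1 z2 e1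
      have := (rq _ _ k1).1 z1
      have := (rq _ _ k2).1 z2
      refine ⟨Quotient.mk st z, ?_, ?_⟩
      · simpa using (rq _ _ k1).1 z1
      · simpa using (rq _ _ k2).1 z2)
  refine ⟨r, r1, r2, fun i => {x | Quotient.mk st x = φ i}, ?_, ?_, ?_, ?_⟩
  · intro i
    exact ⟨(φ i).out, Quotient.out_eq _⟩
  · rw [Set.eq_univ_iff_forall]
    intro x
    obtain ⟨i, hi, h⟩ := f1 (Quotient.mk st x)
    exact Set.mem_iUnion.2 ⟨⟨i, hi⟩, h.symm⟩
  · intro i j hij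
    rw [Set.disjoint_left]
    intro x hx hx'
    exact hij (Fin.ext (f2 _ _ i.2 j.2 (hx.symm.trans hx')))
  · intro i j hij x hx y hy
    have hx : Quotient.mk st x = φ i := hx
    have hy : Quotient.mk st y = φ j := hy
    rw [← f3, ← hx, ← hy]
    apply rq
    apply ne
    rw [hx, hy]
    intro k
    exact hij (Fin.ext (f2 _ _ i.2 j.2 k))

/-- a vertex complete to a `J_k` gives `K_n` -/
theorem JtoK (T : Tournament V) {n k : ℕ} (hn : 3 ≤ n) (hk : n ≤ k) {S : Set V} {w : V}
    (hw : ∀ x ∈ S, T.rel w x) (hJ : T.HasSubIn S (JJrel k)) : T.HasSub (KKrel n) := by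
  obtain ⟨f, -, fS, hf⟩ := hJ
  have k0 : 0 < k := by omega
  let g : ℕ → V := fun i => if h : i < k then f ⟨i, h⟩ else f ⟨0, k0⟩
  have gg : ∀ i, (h : i < k) → g i = f ⟨i, h⟩ := fun i h => dif_pos h
  refine T.mkK hn (w := w) (p := g 0) (q := g (k - 1)) (g := fun i => g (i + 1)) ?_ ?_ ?_ ?_ ?_ ?_ ?_
  · intro i j h1 h2
    rw [gg _ (by omega), gg _ (by omega), ← hf]
    simp only [JJrel]; omega
  · intro i h1
    rw [gg _ (by omega), gg _ (by omega), ← hf]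
    simp only [JJrel]; omega
  · intro i h1
    rw [gg _ (by omega), gg _ (by omega), ← hf]
    simp only [JJrel]; omega
  · rw [gg _ (by omega), gg _ (by omega), ← hf]
    exact Or.inr ⟨rfl, rfl⟩
  · rw [gg _ (by omega)]; exact hw _ (fS _)
  · rw [gg _ (by omega)]; exact hw _ (fS _)
  · intro i h1
    rw [gg _ (by omega)]; exact hw _ (fS _)

theorem TT_in (r : ℕ) (hr : 3 ≤ r) (i : Fin r) : ∃ j, j ≠ i ∧ TTrel r j i := by
  by_cases h : i.val = 0
  · refine ⟨⟨r - 1, by omega⟩, ?_, ?_⟩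
    · intro k; rw [← k] at h; simp at h; omega
    · simp only [TTrel, h]
      have : 0 + r - (r - 1) = 1 := by omega
      rw [this, Nat.mod_eq_of_lt (by omega)]; omega
  · have hi := i.2
    refine ⟨⟨i.val - 1, by omega⟩, ?_, ?_⟩
    · intro k; have := congrArg Fin.val k; simp at this; omega
    · simp only [TTrel]
      have : i.val + r - (i.val - 1) = 1 + r := by omega
      rw [this, Nat.add_mod_right, Nat.mod_eq_of_lt (by omega)]; omega

end Tournament

/-- For each `n ≥ 3` there exists `k` such that every tournament with no subtournament
isomorphic to `K_n` or `K_n^*` can be written as `T_r(H_1, …, H_r)` with `r ≥ 1` odd and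
no `H_i` having a subtournament isomorphic to `J_k`. -/
theorem stmt18 (n : ℕ) (hn : 3 ≤ n) :
    ∃ k : ℕ, 3 ≤ k ∧ ∀ (V : Type) [Fintype V] [Nonempty V] (T : Tournament V),
      ¬ T.HasSub (KKrel n) → ¬ T.HasSub (KKsrel n) →
      ∃ r : ℕ, Odd r ∧ ∃ P : Fin r → Set V,
        (∀ i, (P i).Nonempty) ∧ (⋃ i, P i) = Set.univ ∧
        (∀ i j, i ≠ j → Disjoint (P i) (P j)) ∧
        (∀ i j, i ≠ j → ∀ u ∈ P i, ∀ v ∈ P j, (T.rel u v ↔ TTrel r i j)) ∧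
        ∀ i, ¬ T.HasSubIn (P i) (JJrel k) := by
  refine ⟨2 ^ 7 * (n + 1) + 2, by omega, ?_⟩
  intro V _ _ T hK hKs
  by_cases hJ : T.HasSub (JJrel (2 ^ 7 * (n + 1) + 2))
  · obtain ⟨e, he⟩ := T.exGood hn hK hKs rfl hJ
    obtain ⟨r, r1, r2, P, p1, p2, p3, p4⟩ := T.final he
    refine ⟨r, r1, P, p1, p2, p3, p4, ?_⟩
    intro i hJi
    obtain ⟨j, hj, hji⟩ := Tournament.TT_in r r2 i
    obtain ⟨w, hw⟩ := p1 j
    exact hK (T.JtoK hn (by omega) (fun x hx => (p4 j i hj w hw x hx).2 hji) hJi)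
  · refine ⟨1, odd_one, fun _ => Set.univ, fun _ => Set.univ_nonempty, ?_, ?_, ?_, ?_⟩
    · exact Set.eq_univ_iff_forall.2 (fun x => Set.mem_iUnion.2 ⟨0, trivial⟩)
    · intro i j h; exact absurd (Subsingleton.elim i j) h
    · intro i j h; exact absurd (Subsingleton.elim i j) h
    · rintro i ⟨f, h1, -, h2⟩
      exact hJ ⟨f, h1, h2⟩
end

section
/- For each k ≥ 3, there exists n such that if a tournament G can be written as T_r(H_1,…,H_r), where r ≥ 1 is odd and for each 1 ≤ i ≤ r the tournament H_i has no subtournament isomorphic to J_k, then G has no subtournament isomorphic to K_n or to K_n*. (In fact n = k + 1 suffices.) -/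
theorem TTrel_iff' (n : ℕ) (i j : Fin n) : TTrel n i j ↔
    (i.val < j.val ∧ j.val - i.val ≤ n / 2) ∨ (j.val < i.val ∧ j.val + n - i.val ≤ n / 2) := by
  unfold TTrel
  have hi := i.2
  have hj := j.2
  rcases lt_or_ge j.val i.val with h | h
  · rw [Nat.mod_eq_of_lt (by omega)]; omega
  · have : j.val + n - i.val = (j.val - i.val) + n := by omega
    rw [this, Nat.add_mod_right, Nat.mod_eq_of_lt (by omega)]; omega

theorem key19 {V : Type} (T : Tournament V) (r : ℕ) (p : V → Fin r)
    (hp : ∀ u v, p u ≠ p v → (T.rel u v ↔ TTrel r (p u) (p v)))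
    (a x y z : V) (hxy : T.rel x y) (hyz : T.rel y z) (hzx : T.rel z x)
    (ha : (T.rel a x ∧ T.rel a y ∧ T.rel a z) ∨ (T.rel x a ∧ T.rel y a ∧ T.rel z a)) :
    p x = p y ∧ p y = p z := by
  -- a vertex outside a part is uniform to the part
  have hom : ∀ u v w, p u = p v → p u ≠ p w → T.rel u w → T.rel w v → False := by
    intro u v w h1 h2 h3 h4
    have h5 := (hp u w h2).1 h3
    rw [h1] at h5 h2
    exact T.asymm _ _ h4 ((hp v w h2).2 h5)
  by_cases h1 : p x = p y
  · refine ⟨h1, ?_⟩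
    by_contra h2
    exact hom y x z h1.symm h2 hyz hzx
  exfalso
  by_cases h2 : p y = p z
  · exact hom z y x h2.symm (fun h => h1 (by rw [h2, h])) hzx hxy
  by_cases h3 : p z = p x
  · exact hom x z y h3.symm h1 hxy hyz
  have key : p a ≠ p x ∧ p a ≠ p y ∧ p a ≠ p z := by
    rcases ha with ⟨b1, b2, b3⟩ | ⟨b1, b2, b3⟩
    · refine ⟨fun h => ?_, fun h => ?_, fun h => ?_⟩
      · exact hom a x z h (fun h' => h3 (by rw [← h', h])) b3 hzx
      · exact hom a y x h (fun h' => h1 (by rw [← h', h])) b1 hxy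
      · exact hom a z y h (fun h' => h2 (by rw [← h', h])) b2 hyz
    · refine ⟨fun h => ?_, fun h => ?_, fun h => ?_⟩
      · exact hom x a y h.symm h1 hxy b2
      · exact hom y a z h.symm h2 hyz b3
      · exact hom z a x h.symm h3 hzx b1
  obtain ⟨k1, k2, k3⟩ := key
  have e1 := (TTrel_iff' _ _ _).1 ((hp _ _ h1).1 hxy)
  have e2 := (TTrel_iff' _ _ _).1 ((hp _ _ h2).1 hyz)
  have e3 := (TTrel_iff' _ _ _).1 ((hp _ _ h3).1 hzx)
  have l1 := (p a).2
  have l2 := (p x).2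
  have l3 := (p y).2
  have l4 := (p z).2
  rcases ha with ⟨b1, b2, b3⟩ | ⟨b1, b2, b3⟩
  · have f1 := (TTrel_iff' _ _ _).1 ((hp _ _ k1).1 b1)
    have f2 := (TTrel_iff' _ _ _).1 ((hp _ _ k2).1 b2)
    have f3 := (TTrel_iff' _ _ _).1 ((hp _ _ k3).1 b3)
    omega
  · have f1 := (TTrel_iff' _ _ _).1 ((hp _ _ k1.symm).1 b1)
    have f2 := (TTrel_iff' _ _ _).1 ((hp _ _ k2.symm).1 b2)
    have f3 := (TTrel_iff' _ _ _).1 ((hp _ _ k3.symm).1 b3)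
    omega

theorem main19 {V : Type} (T : Tournament V) (r k : ℕ) (hk : 3 ≤ k) (p : V → Fin r)
    (hp : ∀ u v, p u ≠ p v → (T.rel u v ↔ TTrel r (p u) (p v)))
    (a : V) (g : Fin k → V) (hg : ∀ i j, JJrel k i j ↔ T.rel (g i) (g j))
    (ha : (∀ i, T.rel a (g i)) ∨ (∀ i, T.rel (g i) a)) :
    ∀ i, p (g i) = p (g ⟨0, by omega⟩) := by
  have step : ∀ i : Fin k, 0 < i.val → i.val < k - 1 →
      p (g ⟨0, by omega⟩) = p (g i) ∧ p (g i) = p (g ⟨k - 1, by omega⟩) := by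
    intro i h1 h2
    refine key19 T r p hp a _ _ _ ((hg _ _).1 ?_) ((hg _ _).1 ?_) ((hg _ _).1 ?_) ?_
    · exact Or.inl ⟨h1, fun h => absurd h.2 (by omega)⟩
    · exact Or.inl ⟨h2, fun h => absurd h.1 (by omega)⟩
    · exact Or.inr ⟨rfl, rfl⟩
    · rcases ha with ha | ha
      · exact Or.inl ⟨ha _, ha _, ha _⟩
      · exact Or.inr ⟨ha _, ha _, ha _⟩
  intro i
  by_cases h0 : i.val = 0
  · congr 2; exact Fin.ext h0
  by_cases h1 : i.val = k - 1
  · have hs := step ⟨1, by omega⟩ (by simp) (by simp; omega)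
    have : i = ⟨k - 1, by omega⟩ := Fin.ext h1
    rw [this, ← hs.2, ← hs.1]
  · exact (step i (by omega) (by omega)).1.symm

/-- For each `k ≥ 3` there exists `n` such that every tournament which can be written as
`T_r(H_1, …, H_r)` with `r ≥ 1` odd and no `H_i` having a subtournament isomorphic to
`J_k` has no subtournament isomorphic to `K_n` or `K_n^*`. -/
theorem stmt19 (k : ℕ) (hk : 3 ≤ k) :
    ∃ n : ℕ, 3 ≤ n ∧ ∀ (V : Type) [Fintype V] (T : Tournament V),
      (∃ r : ℕ, Odd r ∧ ∃ P : Fin r → Set V,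
        (∀ i, (P i).Nonempty) ∧ (⋃ i, P i) = Set.univ ∧
        (∀ i j, i ≠ j → Disjoint (P i) (P j)) ∧
        (∀ i j, i ≠ j → ∀ u ∈ P i, ∀ v ∈ P j, (T.rel u v ↔ TTrel r i j)) ∧
        ∀ i, ¬ T.HasSubIn (P i) (JJrel k)) →
      ¬ T.HasSub (KKrel n) ∧ ¬ T.HasSub (KKsrel n) := by
  refine ⟨k + 1, by omega, ?_⟩
  rintro V _ T ⟨r, -, P, -, hU, -, hrel, hJ⟩
  have hex : ∀ v, ∃ i, v ∈ P i := fun v => by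
    have : v ∈ ⋃ i, P i := by rw [hU]; trivial
    simpa using this
  choose p hpm using hex
  have hp : ∀ u v, p u ≠ p v → (T.rel u v ↔ TTrel r (p u) (p v)) :=
    fun u v h => hrel _ _ h u (hpm u) v (hpm v)
  constructor
  · rintro ⟨f, hf, h⟩
    have hg : ∀ i j : Fin k, JJrel k i j ↔ T.rel (f i.succ) (f j.succ) := by
      intro i j
      rw [← h]
      simp only [JJrel, KKrel, Fin.val_succ]
      omega
    have hc := main19 T r k hk p hp (f 0) (fun i => f i.succ) hg (Or.inl fun i => by
      rw [← h]; simp only [KKrel, Fin.val_succ, Fin.val_zero]; omega)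
    refine hJ (p (f (Fin.succ ⟨0, by omega⟩))) ⟨fun i => f i.succ,
      fun i j hij => Fin.succ_injective _ (hf hij), fun i => ?_, hg⟩
    rw [← hc i]; exact hpm _
  · rintro ⟨f, hf, h⟩
    have hg : ∀ i j : Fin k, JJrel k i j ↔ T.rel (f i.castSucc) (f j.castSucc) := by
      intro i j
      rw [← h]
      simp only [JJrel, KKsrel, Fin.val_castSucc]
      omega
    have hc := main19 T r k hk p hp (f (Fin.last k)) (fun i => f i.castSucc) hg
      (Or.inr fun i => by
        rw [← h]; simp only [KKsrel, Fin.val_castSucc, Fin.val_last]; omega)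
    refine hJ (p (f (Fin.castSucc ⟨0, by omega⟩))) ⟨fun i => f i.castSucc,
      fun i j hij => Fin.castSucc_injective _ (hf hij),
      fun i => ?_, hg⟩
    rw [← hc i]; exact hpm _
end
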